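/- arXiv:1210.1888 — 6 statements merged into one kernel-verified Lean document; each statement's English description precedes it below -/
import Mathlib

section
/- Let v_p, v_q, v_r, v_s, u_r ∈ ℂ³ satisfy the flag condition u_r·v_r = 0. Then (u_r·v_p) · det(v_q, v_r, v_s) = (u_r·v_q) · det(v_p, v_r, v_s) + (u_r·v_s) · det(v_p, v_q, v_r). (This is the paper's 3-term skein relation J_p^r J_{qrs} = J_q^r J_{prs} + J_s^r J_{pqr}.) -/
open Matrix

/-- 3-term skein relation `J_p^r J_{qrs} = J_q^r J_{prs} + J_s^r J_{pqr}`. -/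
theorem skein_J_pr_Jqrs (vp vq vr vs ur : Fin 3 → ℂ) (hr : ur ⬝ᵥ vr = 0) :
    (ur ⬝ᵥ vp) * Matrix.det (Matrix.of ![vq, vr, vs]) =
      (ur ⬝ᵥ vq) * Matrix.det (Matrix.of ![vp, vr, vs]) +
        (ur ⬝ᵥ vs) * Matrix.det (Matrix.of ![vp, vq, vr]) := by
  simp only [Matrix.det_fin_three, dotProduct, Fin.sum_univ_three, Matrix.of_apply,
    Matrix.cons_val] at hr ⊢
  linear_combination
    -(vp 0 * vq 1 * vs 2 - vp 0 * vq 2 * vs 1 - vp 1 * vq 0 * vs 2 + vp 1 * vq 2 * vs 0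
      + vp 2 * vq 0 * vs 1 - vp 2 * vq 1 * vs 0) * hr
end

section
/- Let u_p, u_{p+1}, u_{p+2}, v_p, v_{p+1}, v_{p+2} ∈ ℂ³ satisfy the partner relations v_p = u_p × u_{p+1} and u_{p+1} = v_{p+1} × v_{p+2}, together with the flag condition u_{p+2}·v_{p+2} = 0. Then u_{p+2}·v_p = (u_p·v_{p+2}) · (u_{p+2}·v_{p+1}). (This is the paper's factorization rule: if p is white and p+1 is black then J_p^{p+2} = J_{p+2}^p J_{p+1}^{p+2}.) -/
open Matrix

/-- Factorization rule: if `p` is white and `p+1` is black then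
`J_p^{p+2} = J_{p+2}^p J_{p+1}^{p+2}`, given the partner relations
`v_p = u_p × u_{p+1}`, `u_{p+1} = v_{p+1} × v_{p+2}` and the flag condition
`u_{p+2} · v_{p+2} = 0`. -/
theorem factor_J_p_p2 (up up1 up2 vp vp1 vp2 : Fin 3 → ℂ)
    (h1 : vp = crossProduct up up1) (h2 : up1 = crossProduct vp1 vp2)
    (hflag : up2 ⬝ᵥ vp2 = 0) :
    up2 ⬝ᵥ vp = (up ⬝ᵥ vp2) * (up2 ⬝ᵥ vp1) := by
  subst h1 h2
  simp only [cross_apply, vec3_dotProduct, cons_val] at hflag ⊢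
  linear_combination -(up 0 * vp1 0 + up 1 * vp1 1 + up 2 * vp1 2) * hflag
end

section
/- The ring of invariants R_{a,b} is a finitely generated ℂ-algebra and a unique factorization domain. -/
open Matrix MvPolynomial

/-- Evaluation of a polynomial in the variables `y_{il}, x_{lj}` at a pair of matrices. -/
noncomputable def evalAt {a b : ℕ} (y : Matrix (Fin a) (Fin 3) ℂ)
    (x : Matrix (Fin 3) (Fin b) ℂ) :
    MvPolynomial ((Fin a × Fin 3) ⊕ (Fin 3 × Fin b)) ℂ →+* ℂ :=
  MvPolynomial.eval (Sum.elim (fun p => y p.1 p.2) (fun p => x p.1 p.2))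

/-- The ring `R_{a,b}` of `SL(3,ℂ)` invariants of `a` covectors and `b` vectors:
polynomials `f` in the entries of a generic `a×3` matrix `y` and a generic `3×b`
matrix `x` such that `f(y g⁻¹, g x) = f(y, x)` for all `g ∈ SL(3,ℂ)`. -/
noncomputable def invariantRing (a b : ℕ) :
    Subalgebra ℂ (MvPolynomial ((Fin a × Fin 3) ⊕ (Fin 3 × Fin b)) ℂ) where
  carrier := {f | ∀ (g : Matrix.SpecialLinearGroup (Fin 3) ℂ)
      (y : Matrix (Fin a) (Fin 3) ℂ) (x : Matrix (Fin 3) (Fin b) ℂ),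
      evalAt (y * ((g⁻¹ : Matrix.SpecialLinearGroup (Fin 3) ℂ) : Matrix (Fin 3) (Fin 3) ℂ))
          (((g : Matrix (Fin 3) (Fin 3) ℂ)) * x) f = evalAt y x f}
  mul_mem' := by
    intro f₁ f₂ h₁ h₂ g y x
    simp only [_root_.map_mul, h₁ g y x, h₂ g y x]
  add_mem' := by
    intro f₁ f₂ h₁ h₂ g y x
    simp only [_root_.map_add, h₁ g y x, h₂ g y x]
  algebraMap_mem' := by
    intro c g y x
    simp [evalAt, MvPolynomial.algebraMap_eq]

namespace MvPolynomial

variable {σ k : Type*} [Field k]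

theorem homogeneousComponent_mul_of_isHomogeneous (p : MvPolynomial σ k) {q : MvPolynomial σ k}
    {m : ℕ} (hq : q.IsHomogeneous m) (n : ℕ) :
    homogeneousComponent n (p * q) =
      if m ≤ n then homogeneousComponent (n - m) p * q else 0 := by
  conv_lhs => rw [← sum_homogeneousComponent p, Finset.sum_mul, map_sum]
  have h (i : ℕ) : homogeneousComponent n (homogeneousComponent i p * q) =
      if i + m = n then homogeneousComponent i p * q else 0 := by
    have := homogeneousComponent_of_mem (m := n) (n := i + m)
      (p := homogeneousComponent i p * q) ((homogeneousComponent_isHomogeneous i p).mul hq)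
    rw [this]
    simp only [eq_comm]
  simp only [h]
  split_ifs with hmn
  · have h' (i : ℕ) : i + m = n ↔ n - m = i := by omega
    simp only [h', Finset.sum_ite_eq]
    split_ifs with hi
    · rfl
    · rw [homogeneousComponent_eq_zero, zero_mul]
      rw [Finset.mem_range] at hi
      omega
  · exact Finset.sum_eq_zero fun i _ => if_neg (by omega)

/-- **Hilbert's finiteness theorem**: a graded subalgebra of a polynomial ring that is a retract
of it as a module is finitely generated. -/
theorem _root_.Subalgebra.fg_of_retraction [Finite σ] (S : Subalgebra k (MvPolynomial σ k))
    (hS : ∀ f ∈ S, ∀ n, homogeneousComponent n f ∈ S)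
    (E : MvPolynomial σ k →ₗ[S] S) (hE : ∀ f : S, E f = f) : S.FG := by
  obtain ⟨s, hs, hspan⟩ := (Submodule.fg_span_iff_fg_span_finset_subset _).1
    (IsNoetherian.noetherian
      (Ideal.span {f : MvPolynomial σ k | f ∈ S ∧ ∃ n, 0 < n ∧ f.IsHomogeneous n}))
  have key (n : ℕ) : ∀ f ∈ S, f.IsHomogeneous n →
      f ∈ Algebra.adjoin k (s : Set (MvPolynomial σ k)) := by
    induction n using Nat.strong_induction_on with
    | _ n ih =>
    intro f hf hfn
    rcases Nat.eq_zero_or_pos n with rfl | hn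
    · rw [totalDegree_eq_zero_iff_eq_C.1 ((totalDegree_zero_iff_isHomogeneous σ).2 hfn)]
      exact Subalgebra.algebraMap_mem _ _
    have hfs : f ∈ Submodule.span (MvPolynomial σ k) (s : Set (MvPolynomial σ k)) := by
      rw [← hspan]
      exact Submodule.subset_span ⟨hf, n, hn, hfn⟩
    obtain ⟨c, -, hc⟩ := Submodule.mem_span_finset.1 hfs
    have hEf : f = ∑ g ∈ s, (E (c g) : MvPolynomial σ k) * g := by
      have h1 : (E f : MvPolynomial σ k) = f := congrArg Subtype.val (hE ⟨f, hf⟩)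
      rw [← h1, ← hc, map_sum, AddSubmonoidClass.coe_finsetSum]
      refine Finset.sum_congr rfl fun g hg => ?_
      have h2 := E.map_smul ⟨g, (hs hg).1⟩ (c g)
      rw [smul_eq_mul, mul_comm, mul_comm _ g]
      exact congrArg Subtype.val h2
    rw [← homogeneousComponent_eq_self hfn, hEf, map_sum]
    refine Subalgebra.sum_mem _ fun g hg => ?_
    obtain ⟨-, m, hm, hgm⟩ := hs hg
    rw [homogeneousComponent_mul_of_isHomogeneous _ hgm]
    split_ifs with hmn
    · exact Subalgebra.mul_mem _ (ih (n - m) (by omega) _ (hS _ (E (c g)).2 _)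
        (homogeneousComponent_isHomogeneous _ _)) (Algebra.subset_adjoin hg)
    · exact Subalgebra.zero_mem _
  refine ⟨s, le_antisymm (Algebra.adjoin_le fun g hg => (hs hg).1) fun f hf => ?_⟩
  rw [← sum_homogeneousComponent f]
  exact Subalgebra.sum_mem _ fun n _ => key n _ (hS f hf n) (homogeneousComponent_isHomogeneous n f)

end MvPolynomial
/-- A subalgebra of a factorial domain which contains every divisor of each of its nonzero
elements is itself factorial. -/
theorem Subalgebra.uniqueFactorizationMonoid_of_factorially_closed {k A : Type*} [CommRing k]
    [CommRing A] [IsDomain A] [Algebra k A] [UniqueFactorizationMonoid A] (S : Subalgebra k A)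
    (hS : ∀ x y : A, x * y ∈ S → x * y ≠ 0 → x ∈ S) : UniqueFactorizationMonoid S := by
  have hprime (p : A) (hp : Prime p) (hpS : p ∈ S) : Prime (⟨p, hpS⟩ : S) := by
    refine ⟨fun h => hp.ne_zero (congrArg Subtype.val h), fun h => hp.not_isUnit (h.map S.val), ?_⟩
    have key (u : S) (hu : p ∣ (u : A)) : (⟨p, hpS⟩ : S) ∣ u := by
      obtain ⟨c, hc⟩ := hu
      by_cases h0 : (u : A) = 0
      · rw [show u = 0 from Subtype.ext h0]
        exact dvd_zero _
      · refine ⟨⟨c, hS c p ?_ ?_⟩, Subtype.ext hc⟩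
        · rw [mul_comm, ← hc]; exact u.2
        · rwa [mul_comm, ← hc]
    rintro u v ⟨c, hc⟩
    have : p ∣ (u : A) * v := ⟨c, congrArg Subtype.val hc⟩
    exact (hp.dvd_or_dvd this).imp (key u) (key v)
  have main (x : A) : ∀ hx : x ∈ S, x ≠ 0 →
      ∃ m : Multiset S, (∀ q ∈ m, Prime q) ∧ Associated m.prod ⟨x, hx⟩ := by
    induction x using UniqueFactorizationMonoid.induction_on_prime with
    | h₁ => exact fun _ h => absurd rfl h
    | h₂ u hu =>
      intro hx h0
      obtain ⟨v, hv⟩ := hu.exists_right_inv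
      have hvS : v ∈ S := hS v u (by rw [mul_comm, hv]; exact S.one_mem)
        (by rw [mul_comm, hv]; exact one_ne_zero)
      refine ⟨0, by simp, ?_⟩
      rw [Multiset.prod_zero]
      refine associated_one_iff_isUnit.2 (.of_mul_eq_one ⟨v, hvS⟩ (Subtype.ext hv)) |>.symm
    | h₃ u p hu hp ih =>
      intro hx h0
      have hpS : p ∈ S := hS p u hx h0
      have huS : u ∈ S := hS u p (by rwa [mul_comm]) (by rwa [mul_comm])
      obtain ⟨m, hm, hmu⟩ := ih huS hu
      refine ⟨⟨p, hpS⟩ ::ₘ m, ?_, ?_⟩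
      · intro q hq
        rcases Multiset.mem_cons.1 hq with rfl | hq
        exacts [hprime p hp hpS, hm q hq]
      · rw [Multiset.prod_cons]
        exact hmu.mul_left ⟨p, hpS⟩
  exact UniqueFactorizationMonoid.of_exists_prime_factors fun x hx =>
    main x.1 x.2 fun h => hx (Subtype.ext h)

/-- An automorphism of a factorial domain that has, for each `n > 0`, an `n`-th root fixing
`f ≠ 0`, maps each divisor of `f` to an associate. -/
theorem RingAut.associated_apply_of_dvd {A : Type*} [CommRing A] [IsDomain A]
    [UniqueFactorizationMonoid A] (σ : A ≃+* A) {f d : A} (hf : f ≠ 0)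
    (hσ : ∀ n : ℕ, 0 < n → ∃ τ : A ≃+* A, τ f = f ∧ ∀ x, (⇑τ)^[n] x = σ x) (hd : d ∣ f) :
    Associated (σ d) d := by
  classical
  let T := {x : Associates A // x ∣ Associates.mk f}
  have : Fintype T := UniqueFactorizationMonoid.fintypeSubtypeDvd _ (Associates.mk_ne_zero.2 hf)
  obtain ⟨τ, hτf, hτ⟩ := hσ (Fintype.card (Equiv.Perm T)) Fintype.card_pos
  let M (ρ : A ≃+* A) : Associates A → Associates A := Quotient.map ρ fun _ _ h => h.map ρ
  have hM (ρ : A ≃+* A) (x : A) : M ρ (Associates.mk x) = Associates.mk (ρ x) := rfl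
  have hdvd (ρ : A ≃+* A) (hρ : ρ f = f) (t : Associates A) (ht : t ∣ Associates.mk f) :
      M ρ t ∣ Associates.mk f := by
    obtain ⟨x, rfl⟩ := Associates.mk_surjective t
    rw [hM, Associates.mk_dvd_mk]
    simpa [hρ] using map_dvd ρ (Associates.mk_dvd_mk.1 ht)
  have hsymm : τ.symm f = f := by rw [RingEquiv.symm_apply_eq, hτf]
  let e : Equiv.Perm T :=
    { toFun := fun t => ⟨_, hdvd τ hτf t.1 t.2⟩
      invFun := fun t => ⟨_, hdvd τ.symm hsymm t.1 t.2⟩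
      left_inv := by
        rintro ⟨t, ht⟩
        obtain ⟨x, rfl⟩ := Associates.mk_surjective t
        simp [hM]
      right_inv := by
        rintro ⟨t, ht⟩
        obtain ⟨x, rfl⟩ := Associates.mk_surjective t
        simp [hM] }
  let t₀ : T := ⟨Associates.mk d, Associates.mk_dvd_mk.2 hd⟩
  have hpow (n : ℕ) : ((e ^ n) t₀).1 = Associates.mk ((⇑τ)^[n] d) := by
    induction n with
    | zero => rfl
    | succ n ih =>
      rw [pow_succ', Equiv.Perm.mul_apply, Function.iterate_succ_apply']
      change M τ ((e ^ n) t₀).1 = _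
      rw [ih, hM]
  have := hpow (Fintype.card (Equiv.Perm T))
  rw [pow_card_eq_one, hτ] at this
  exact (Associates.mk_eq_mk_iff_associated.1 this).symm

/-- `SL(3)` over a field is generated by transvections. -/
theorem Matrix.SpecialLinearGroup.transvection_induction_fin_three {F : Type*} [Field F]
    (P : SpecialLinearGroup (Fin 3) F → Prop)
    (htransvec : ∀ (i j : Fin 3) (h : i ≠ j) (c : F), P (SpecialLinearGroup.transvection h c))
    (hmul : ∀ A B, P A → P B → P (A * B)) (A : SpecialLinearGroup (Fin 3) F) : P A := by
  refine diagonal_transvection_induction' P _ (fun i j hij c hc => ?_) htransvec hmul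
  have hw (x : F) (hx : x ≠ 0) : ((SpecialLinearGroup.transvection hij x *
      SpecialLinearGroup.transvection hij.symm (-x⁻¹) *
      SpecialLinearGroup.transvection hij x : SpecialLinearGroup (Fin 3) F) :
        Matrix (Fin 3) (Fin 3) F) = 1 + Matrix.single i j x + Matrix.single j i (-x⁻¹) -
          Matrix.single i i 1 - Matrix.single j j 1 := by
    simp only [SpecialLinearGroup.coe_mul, transvection_coe, mul_add, add_mul, mul_one, one_mul,
      Matrix.single_mul_single_same, Matrix.single_mul_single_of_ne _ _ _ _ hij.symm,
      mul_neg, neg_mul, mul_inv_cancel₀ hx, inv_mul_cancel₀ hx]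
    ext k l
    simp only [Matrix.add_apply, Matrix.sub_apply, Matrix.single_apply, Matrix.one_apply,
      Matrix.zero_apply]
    grind
  have : diag2n hij c hc = (SpecialLinearGroup.transvection hij c *
      SpecialLinearGroup.transvection hij.symm (-c⁻¹) *
      SpecialLinearGroup.transvection hij c) *
      (SpecialLinearGroup.transvection hij (-1) *
      SpecialLinearGroup.transvection hij.symm (-(-1)⁻¹) *
      SpecialLinearGroup.transvection hij (-1)) := by
    refine Subtype.ext ?_
    rw [SpecialLinearGroup.coe_mul, hw c hc, hw (-1) (by simp), diag2n_coe]
    simp only [mul_add, add_mul, mul_one, one_mul, mul_sub, sub_mul,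
      Matrix.single_mul_single_same, Matrix.single_mul_single_of_ne _ _ _ _ hij.symm,
      Matrix.single_mul_single_of_ne _ _ _ _ hij]
    ext k l
    simp only [Matrix.add_apply, Matrix.sub_apply, Matrix.single_apply, Matrix.diagonal_apply,
      Matrix.one_apply]
    grind
  rw [this]
  refine hmul _ _ (hmul _ _ (hmul _ _ ?_ ?_) ?_) (hmul _ _ (hmul _ _ ?_ ?_) ?_)
  all_goals exact htransvec _ _ _ _

/-- In `SL(3)` a transvection measures the failure of two other transvections to commute. -/
theorem Matrix.SpecialLinearGroup.transvection_mul_transvection_fin_three {F : Type*} [Field F]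
    {i j k : Fin 3} (hij : i ≠ j) (hik : i ≠ k) (hkj : k ≠ j) (c : F) :
    SpecialLinearGroup.transvection hik c * SpecialLinearGroup.transvection hkj 1 =
      SpecialLinearGroup.transvection hij c * (SpecialLinearGroup.transvection hkj 1 *
        SpecialLinearGroup.transvection hik c) := by
  refine Subtype.ext ?_
  simp only [SpecialLinearGroup.coe_mul, transvection_coe, mul_add, add_mul, mul_one, one_mul,
    Matrix.single_mul_single_same, Matrix.single_mul_single_of_ne _ _ _ _ hij.symm,
    Matrix.single_mul_single_of_ne _ _ _ _ hkj.symm]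
  simp only [mul_zero, add_zero]
  abel
namespace invariantRing

variable {a b : ℕ}

/-- The coordinate ring of pairs of matrices. -/
abbrev Poly (a b : ℕ) : Type := MvPolynomial ((Fin a × Fin 3) ⊕ (Fin 3 × Fin b)) ℂ

theorem evalAt_ext {f h : Poly a b}
    (H : ∀ y x, evalAt y x f = evalAt y x h) : f = h := by
  refine MvPolynomial.funext fun z => ?_
  convert H (Matrix.of fun i l => z (.inl (i, l))) (Matrix.of fun l j => z (.inr (l, j))) using 1
  all_goals
    unfold evalAt
    congr 2
    funext s
    rcases s with s | s <;> rfl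

/-- The polynomial obtained from `f` by substituting `(y h, g x)` for `(y, x)`, where the
entries of the square matrices `h` and `g` lie in a `ℂ`-algebra. -/
noncomputable def subst {A : Type*} [CommRing A] [Algebra ℂ A] (h g : Matrix (Fin 3) (Fin 3) A) :
    Poly a b →ₐ[ℂ]
      MvPolynomial ((Fin a × Fin 3) ⊕ (Fin 3 × Fin b)) A :=
  aeval (Sum.elim (fun p => ∑ k, X (Sum.inl (p.1, k)) * C (h k p.2))
    (fun p => ∑ k, C (g p.1 k) * X (Sum.inr (k, p.2))))

theorem eval_map_subst {A : Type*} [CommRing A] [Algebra ℂ A] (h g : Matrix (Fin 3) (Fin 3) A)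
    (φ : A →ₐ[ℂ] ℂ) (y : Matrix (Fin a) (Fin 3) ℂ) (x : Matrix (Fin 3) (Fin b) ℂ)
    (f : Poly a b) :
    evalAt y x (MvPolynomial.map (φ : A →+* ℂ) (subst h g f)) =
      evalAt (y * h.map φ) (g.map φ * x) f := by
  induction f using MvPolynomial.induction_on with
  | C r =>
    have : φ (algebraMap ℂ A r) = r := by simp
    simp [evalAt, subst]
  | add p q hp hq => simp only [map_add, hp, hq]
  | mul_X p s hp =>
    simp only [map_mul, hp]
    congr 1
    rcases s with s | s <;> simp [evalAt, subst, Matrix.mul_apply]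

/-- The automorphism `f(y, x) ↦ f(y g⁻¹, g x)` of the polynomial ring. -/
noncomputable def act (g : Matrix.SpecialLinearGroup (Fin 3) ℂ) :
    Poly a b →ₐ[ℂ]
      Poly a b :=
  subst ((g⁻¹ : Matrix.SpecialLinearGroup (Fin 3) ℂ) : Matrix (Fin 3) (Fin 3) ℂ)
    (g : Matrix (Fin 3) (Fin 3) ℂ)

theorem evalAt_act (g : Matrix.SpecialLinearGroup (Fin 3) ℂ) (y : Matrix (Fin a) (Fin 3) ℂ)
    (x : Matrix (Fin 3) (Fin b) ℂ) (f : Poly a b) :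
    evalAt y x (act g f) =
      evalAt (y * ((g⁻¹ : Matrix.SpecialLinearGroup (Fin 3) ℂ) : Matrix (Fin 3) (Fin 3) ℂ))
        ((g : Matrix (Fin 3) (Fin 3) ℂ) * x) f := by
  have := eval_map_subst ((g⁻¹ : Matrix.SpecialLinearGroup (Fin 3) ℂ) : Matrix (Fin 3) (Fin 3) ℂ)
    (g : Matrix (Fin 3) (Fin 3) ℂ) (AlgHom.id ℂ ℂ) y x f
  rw [AlgHom.id_toRingHom, MvPolynomial.map_id, AlgHom.coe_id, Matrix.map_id, Matrix.map_id] at this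
  exact this

theorem mem_iff_act {f : Poly a b} :
    f ∈ invariantRing a b ↔ ∀ g : Matrix.SpecialLinearGroup (Fin 3) ℂ, act g f = f := by
  refine ⟨fun h g => evalAt_ext fun y x => (evalAt_act g y x f).trans (h g y x),
    fun h g y x => ?_⟩
  rw [← evalAt_act, h g]

theorem act_mul (g h : Matrix.SpecialLinearGroup (Fin 3) ℂ)
    (f : Poly a b) :
    act (g * h) f = act h (act g f) :=
  evalAt_ext fun y x => by
    simp only [evalAt_act, _root_.mul_inv_rev, Matrix.SpecialLinearGroup.coe_mul, Matrix.mul_assoc]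

theorem act_one (f : Poly a b) :
    act 1 f = f :=
  evalAt_ext fun y x => by
    simp only [evalAt_act, inv_one, Matrix.SpecialLinearGroup.coe_one, Matrix.mul_one,
      Matrix.one_mul]

/-- `act g` as a ring automorphism. -/
noncomputable def actEquiv (g : Matrix.SpecialLinearGroup (Fin 3) ℂ) : Poly a b ≃+* Poly a b :=
  (AlgEquiv.ofAlgHom (act g) (act g⁻¹)
    (AlgHom.ext fun f => by
      rw [AlgHom.comp_apply, ← act_mul, inv_mul_cancel, act_one, AlgHom.id_apply])
    (AlgHom.ext fun f => by
      rw [AlgHom.comp_apply, ← act_mul, mul_inv_cancel, act_one, AlgHom.id_apply])).toRingEquiv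

theorem actEquiv_apply (g : Matrix.SpecialLinearGroup (Fin 3) ℂ) (f : Poly a b) :
    actEquiv g f = act g f := rfl

theorem coe_actEquiv (g : Matrix.SpecialLinearGroup (Fin 3) ℂ) :
    ⇑(actEquiv (a := a) (b := b) g) = act g := rfl

theorem iterate_act (g : Matrix.SpecialLinearGroup (Fin 3) ℂ) (n : ℕ)
    (f : Poly a b) :
    (act g)^[n] f = act (g ^ n) f := by
  induction n with
  | zero => rw [pow_zero, act_one]; rfl
  | succ n ih => rw [Function.iterate_succ_apply', ih, ← act_mul, pow_succ]

theorem transvection_pow {i j : Fin 3} (hij : i ≠ j) (c : ℂ) (n : ℕ) :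
    Matrix.SpecialLinearGroup.transvection hij c ^ n =
      Matrix.SpecialLinearGroup.transvection hij (n * c) := by
  induction n with
  | zero => simp
  | succ n ih =>
    rw [pow_succ, ih, ← Matrix.SpecialLinearGroup.transvection_add]
    push_cast
    ring_nf

theorem exists_act_transvection_eq_C_mul {f d : Poly a b}
    (hf : f ∈ invariantRing a b) (hf0 : f ≠ 0) (hd : d ∣ f) {i j : Fin 3} (hij : i ≠ j) (c : ℂ) :
    ∃ r : ℂ, r ≠ 0 ∧ act (Matrix.SpecialLinearGroup.transvection hij c) d = C r * d := by
  have : Associated (actEquiv (Matrix.SpecialLinearGroup.transvection hij c) d) d := by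
    refine RingAut.associated_apply_of_dvd _ hf0 (fun n hn => ?_) hd
    refine ⟨actEquiv (Matrix.SpecialLinearGroup.transvection hij (c / n)),
      (actEquiv_apply _ _).trans (mem_iff_act.1 hf _),
      fun x => ?_⟩
    have hn' : (n : ℂ) ≠ 0 := by exact_mod_cast hn.ne'
    rw [coe_actEquiv, coe_actEquiv, iterate_act, transvection_pow, mul_div_cancel₀ _ hn']
  obtain ⟨u, hu⟩ := this.symm
  obtain ⟨r, hr, hru⟩ := MvPolynomial.isUnit_iff_eq_C_of_isReduced.1 u.isUnit
  exact ⟨r, hr.ne_zero, by rw [← actEquiv_apply, ← hu, hru, mul_comm]⟩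

theorem mem_of_dvd {f d : Poly a b}
    (hf : f ∈ invariantRing a b) (hf0 : f ≠ 0) (hd : d ∣ f) : d ∈ invariantRing a b := by
  have hd0 : d ≠ 0 := ne_zero_of_dvd_ne_zero hf0 hd
  refine mem_iff_act.2 fun g => ?_
  induction g using SpecialLinearGroup.transvection_induction_fin_three with
  | hmul A B hA hB => rw [act_mul, hA, hB]
  | htransvec i j hij c =>
    obtain ⟨k, hik, hkj⟩ : ∃ k : Fin 3, i ≠ k ∧ k ≠ j := by
      revert i j
      decide
    obtain ⟨r, hr, hrd⟩ := exists_act_transvection_eq_C_mul hf hf0 hd hik c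
    obtain ⟨s, hs, hsd⟩ := exists_act_transvection_eq_C_mul hf hf0 hd hkj 1
    obtain ⟨t, ht, htd⟩ := exists_act_transvection_eq_C_mul hf hf0 hd hij c
    have hC (g : Matrix.SpecialLinearGroup (Fin 3) ℂ) (z : ℂ) :
        act g (C z : Poly a b) = C z :=
      (act g).commutes z
    have := congrArg (act · d)
      (Matrix.SpecialLinearGroup.transvection_mul_transvection_fin_three hij hik hkj c)
    simp only [act_mul, hrd, hsd, htd, map_mul, hC] at this
    have h2 : C (r * s) * (C t * d - d) = 0 := by
      rw [C_mul]
      linear_combination -this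
    rcases mul_eq_zero.1 h2 with h3 | h3
    · exact absurd (C_eq_zero.1 h3) (mul_ne_zero hr hs)
    · rw [htd, sub_eq_zero.1 h3]

theorem uniqueFactorizationMonoid : UniqueFactorizationMonoid (invariantRing a b) :=
  (invariantRing a b).uniqueFactorizationMonoid_of_factorially_closed
    fun x y h h0 => mem_of_dvd h h0 (dvd_mul_right x y)

theorem differentiable_eval {σ : Type*} {c : ℂ → σ → ℂ}
    (hc : ∀ s, Differentiable ℂ fun z => c z s) (f : MvPolynomial σ ℂ) :
    Differentiable ℂ fun z => MvPolynomial.eval (c z) f := by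
  induction f using MvPolynomial.induction_on with
  | C r => simp
  | add p q hp hq =>
    simp only [map_add]
    exact hp.add hq
  | mul_X p s hp =>
    simp only [map_mul, eval_X]
    exact hp.mul (hc s)

/-- The one-parameter group `z ↦ U diag(exp (z l)) U*` in `SL(3, ℂ)`. -/
noncomputable def oneParam (U : unitaryGroup (Fin 3) ℂ) (l : Fin 3 → ℝ) (hl : ∑ i, l i = 0)
    (z : ℂ) : Matrix.SpecialLinearGroup (Fin 3) ℂ :=
  ⟨U.1 * diagonal (fun i => Complex.exp (z * l i)) * star U.1, by
    rw [det_mul, det_mul, mul_right_comm, ← det_mul, Unitary.mul_star_self_of_mem U.2, det_one,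
      one_mul, det_diagonal, ← Complex.exp_sum, ← Finset.mul_sum]
    rw [← Complex.ofReal_sum, hl, Complex.ofReal_zero, mul_zero, Complex.exp_zero]⟩

theorem oneParam_coe (U : unitaryGroup (Fin 3) ℂ) (l : Fin 3 → ℝ) (hl : ∑ i, l i = 0) (z : ℂ) :
    (oneParam U l hl z : Matrix (Fin 3) (Fin 3) ℂ) =
      U.1 * diagonal (fun i => Complex.exp (z * l i)) * star U.1 := rfl

theorem oneParam_zero (U : unitaryGroup (Fin 3) ℂ) (l : Fin 3 → ℝ) (hl : ∑ i, l i = 0) :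
    oneParam U l hl 0 = 1 := by
  refine Subtype.ext ?_
  rw [oneParam_coe, Matrix.SpecialLinearGroup.coe_one]
  simp only [zero_mul, Complex.exp_zero, diagonal_one, mul_one]
  exact Unitary.mul_star_self_of_mem U.2

theorem oneParam_add (U : unitaryGroup (Fin 3) ℂ) (l : Fin 3 → ℝ) (hl : ∑ i, l i = 0) (z w : ℂ) :
    oneParam U l hl (z + w) = oneParam U l hl z * oneParam U l hl w := by
  refine Subtype.ext ?_
  rw [Matrix.SpecialLinearGroup.coe_mul, oneParam_coe, oneParam_coe, oneParam_coe]
  have : (fun i => Complex.exp ((z + w) * l i)) =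
      fun i => Complex.exp (z * l i) * Complex.exp (w * l i) := by
    funext i
    rw [add_mul, Complex.exp_add]
  rw [this, ← diagonal_mul_diagonal]
  calc _ = U.1 * diagonal (fun i => Complex.exp (z * l i)) * 1 *
        diagonal (fun i => Complex.exp (w * l i)) * star U.1 := by
        simp only [mul_one, Matrix.mul_assoc]
    _ = _ := by
        rw [← Unitary.star_mul_self_of_mem U.2]
        simp only [Matrix.mul_assoc]

theorem differentiable_oneParam (U : unitaryGroup (Fin 3) ℂ) (l : Fin 3 → ℝ) (hl : ∑ i, l i = 0)
    (i j : Fin 3) :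
    Differentiable ℂ fun z => (oneParam U l hl z : Matrix (Fin 3) (Fin 3) ℂ) i j := by
  simp only [oneParam_coe, Matrix.mul_apply (M := _ * _), Matrix.mul_diagonal]
  fun_prop

theorem oneParam_inv (U : unitaryGroup (Fin 3) ℂ) (l : Fin 3 → ℝ) (hl : ∑ i, l i = 0) (z : ℂ) :
    (oneParam U l hl z)⁻¹ = oneParam U l hl (-z) :=
  inv_eq_of_mul_eq_one_right (by rw [← oneParam_add, add_neg_cancel, oneParam_zero])

theorem star_oneParam (U : unitaryGroup (Fin 3) ℂ) (l : Fin 3 → ℝ) (hl : ∑ i, l i = 0) (z : ℂ) :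
    star (oneParam U l hl z : Matrix (Fin 3) (Fin 3) ℂ) =
      (oneParam U l hl (star z) : Matrix (Fin 3) (Fin 3) ℂ) := by
  rw [oneParam_coe, oneParam_coe, star_mul, star_mul, star_star, Matrix.mul_assoc,
    star_eq_conjTranspose (diagonal _), diagonal_conjTranspose]
  congr 3
  funext i
  simp [← Complex.exp_conj]

theorem oneParam_mem_unitary (U : unitaryGroup (Fin 3) ℂ) (l : Fin 3 → ℝ) (hl : ∑ i, l i = 0)
    (t : ℝ) : (oneParam U l hl (t * Complex.I) : Matrix (Fin 3) (Fin 3) ℂ) ∈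
      unitaryGroup (Fin 3) ℂ := by
  rw [mem_unitaryGroup_iff, star_oneParam, ← Matrix.SpecialLinearGroup.coe_mul, ← oneParam_add]
  simp [oneParam_zero]

theorem act_oneParam {f : Poly a b}
    (hf : ∀ g : Matrix.SpecialLinearGroup (Fin 3) ℂ,
      (g : Matrix (Fin 3) (Fin 3) ℂ) ∈ unitaryGroup (Fin 3) ℂ → act g f = f)
    (U : unitaryGroup (Fin 3) ℂ) (l : Fin 3 → ℝ) (hl : ∑ i, l i = 0) (z : ℂ) :
    act (oneParam U l hl z) f = f := by
  refine evalAt_ext fun y x => ?_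
  have hd : Differentiable ℂ fun w => evalAt y x (act (oneParam U l hl w) f) := by
    simp only [evalAt_act, oneParam_inv]
    refine differentiable_eval (fun s => ?_) f
    have hp := differentiable_oneParam U l hl
    have hn (i j : Fin 3) :
        Differentiable ℂ fun w => (oneParam U l hl (-w) : Matrix (Fin 3) (Fin 3) ℂ) i j :=
      (hp i j).comp differentiable_neg
    rcases s with s | s
    · simp only [Sum.elim_inl, Matrix.mul_apply]
      exact Differentiable.fun_sum fun k _ => (hn k s.2).const_mul (y s.1 k)
    · simp only [Sum.elim_inr, Matrix.mul_apply]
      exact Differentiable.fun_sum fun k _ => (hp s.1 k).mul_const (x k s.2)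
  have han : AnalyticOnNhd ℂ (fun w => evalAt y x (act (oneParam U l hl w) f)) Set.univ :=
    hd.differentiableOn.analyticOnNhd isOpen_univ
  have hlim : Filter.Tendsto (fun n : ℕ => (((1 / ((n : ℝ) + 1) : ℝ) : ℂ) * Complex.I))
      Filter.atTop (nhdsWithin 0 {0}ᶜ) := by
    refine tendsto_nhdsWithin_iff.2 ⟨?_, Filter.Eventually.of_forall fun n => ?_⟩
    · have := (Complex.continuous_ofReal.tendsto 0).comp
        (tendsto_one_div_add_atTop_nhds_zero_nat (𝕜 := ℝ))
      simpa using this.mul_const Complex.I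
    · have : (n : ℝ) + 1 ≠ 0 := by positivity
      simpa using by exact_mod_cast this
  have := han.eq_of_frequently_eq (g := fun _ => evalAt y x f) (z₀ := 0) analyticOnNhd_const
    (hlim.frequently (Filter.Frequently.of_forall fun n => by
      simp only [hf _ (oneParam_mem_unitary U l hl _)]))
  exact congrFun this z

open scoped ComplexOrder in
/-- **Weyl's unitary trick**: invariance under `SU(3)` implies invariance under `SL(3, ℂ)`. -/
theorem mem_of_forall_unitary {f : Poly a b}
    (hf : ∀ g : Matrix.SpecialLinearGroup (Fin 3) ℂ,
      (g : Matrix (Fin 3) (Fin 3) ℂ) ∈ unitaryGroup (Fin 3) ℂ → act g f = f) :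
    f ∈ invariantRing a b := by
  refine mem_iff_act.2 fun g => ?_
  have hpd : (star (g : Matrix (Fin 3) (Fin 3) ℂ) * (g : Matrix (Fin 3) (Fin 3) ℂ)).PosDef :=
    Matrix.PosDef.conjTranspose_mul_self _ (mulVec_injective_of_isUnit
      ((Matrix.isUnit_iff_isUnit_det _).2 (by rw [g.2]; exact isUnit_one)))
  have hH := hpd.isHermitian
  have hpos := hpd.eigenvalues_pos
  have hprod : ∏ i, hH.eigenvalues i = 1 := by
    have hdet : (star (g : Matrix (Fin 3) (Fin 3) ℂ) * (g : Matrix (Fin 3) (Fin 3) ℂ)).det = 1 := by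
      rw [det_mul, star_eq_conjTranspose, det_conjTranspose, g.2, star_one, one_mul]
    exact Complex.ofReal_eq_one.1
      ((Complex.ofReal_prod _ _).trans (hH.det_eq_prod_eigenvalues.symm.trans hdet))
  have hl : ∑ i, Real.log (hH.eigenvalues i) / 2 = 0 := by
    rw [← Finset.sum_div, ← Real.log_prod fun i _ => (hpos i).ne', hprod, Real.log_one, zero_div]
  set p := oneParam hH.eigenvectorUnitary _ hl 1 with hp
  have hpp : (p : Matrix (Fin 3) (Fin 3) ℂ) * p =
      star (g : Matrix (Fin 3) (Fin 3) ℂ) * (g : Matrix (Fin 3) (Fin 3) ℂ) := by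
    rw [← Matrix.SpecialLinearGroup.coe_mul, hp, ← oneParam_add, oneParam_coe]
    conv_rhs => rw [hH.spectral_theorem, Unitary.conjStarAlgAut_apply]
    congr 3
    funext i
    have : (1 + 1 : ℂ) * ((Real.log (hH.eigenvalues i) / 2 : ℝ) : ℂ) =
        ((Real.log (hH.eigenvalues i) : ℝ) : ℂ) := by
      push_cast
      ring
    rw [this, ← Complex.ofReal_exp, Real.exp_log (hpos i)]
    rfl
  have hps : star (p : Matrix (Fin 3) (Fin 3) ℂ) = p := by
    rw [hp, star_oneParam, star_one]
  have hpi : (p : Matrix (Fin 3) (Fin 3) ℂ) *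
      ((p⁻¹ : Matrix.SpecialLinearGroup (Fin 3) ℂ) : Matrix (Fin 3) (Fin 3) ℂ) = 1 := by
    rw [← Matrix.SpecialLinearGroup.coe_mul, mul_inv_cancel, Matrix.SpecialLinearGroup.coe_one]
  have hu : ((g * p⁻¹ : Matrix.SpecialLinearGroup (Fin 3) ℂ) : Matrix (Fin 3) (Fin 3) ℂ) ∈
      unitaryGroup (Fin 3) ℂ := by
    have hpi' : star ((p⁻¹ : Matrix.SpecialLinearGroup (Fin 3) ℂ) : Matrix (Fin 3) (Fin 3) ℂ) *
        (p : Matrix (Fin 3) (Fin 3) ℂ) = 1 := by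
      simpa [hps] using congrArg star hpi
    rw [mem_unitaryGroup_iff', Matrix.SpecialLinearGroup.coe_mul, star_mul, Matrix.mul_assoc,
      ← Matrix.mul_assoc (star (g : Matrix (Fin 3) (Fin 3) ℂ)), ← hpp, Matrix.mul_assoc, hpi,
      Matrix.mul_one, hpi']
  rw [← inv_mul_cancel_right g p, act_mul, hf _ hu]
  exact act_oneParam hf _ _ hl 1

theorem exists_evalAt_eq_integral {K : Type*} [TopologicalSpace K] [CompactSpace K]
    [MeasurableSpace K] [BorelSpace K] (μ : MeasureTheory.Measure K)
    [MeasureTheory.IsFiniteMeasure μ] {F : K → Matrix.SpecialLinearGroup (Fin 3) ℂ}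
    (hF : Continuous F) (f : Poly a b) :
    ∃ p : Poly a b, ∀ y x, MeasureTheory.Integrable (fun k => evalAt y x (act (F k) f)) μ ∧
      evalAt y x p = ∫ k, evalAt y x (act (F k) f) ∂μ := by
  have hc (G : K → Matrix.SpecialLinearGroup (Fin 3) ℂ) (hG : Continuous G) (i j : Fin 3) :
      Continuous fun k => (G k : Matrix (Fin 3) (Fin 3) ℂ) i j :=
    (continuous_subtype_val.comp hG).matrix_elem i j
  set q : MvPolynomial ((Fin a × Fin 3) ⊕ (Fin 3 × Fin b)) C(K, ℂ) :=
    subst (Matrix.of fun i j => ⟨_, hc (fun k => (F k)⁻¹) hF.inv i j⟩)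
      (Matrix.of fun i j => ⟨_, hc F hF i j⟩) f with hq
  have hqe (k : K) (y : Matrix (Fin a) (Fin 3) ℂ) (x : Matrix (Fin 3) (Fin b) ℂ) :
      evalAt y x (act (F k) f) = ∑ m ∈ q.support, q.coeff m k * evalAt y x (monomial m 1) := by
    have h1 := eval_map_subst (Matrix.of fun i j => ⟨_, hc (fun k => (F k)⁻¹) hF.inv i j⟩)
      (Matrix.of fun i j => ⟨_, hc F hF i j⟩) (ContinuousMap.evalAlgHom ℂ ℂ k) y x f
    rw [evalAt_act]
    refine h1.symm.trans ?_
    rw [← hq, evalAt, eval_map, eval₂_eq]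
    simp only [eval_monomial, one_mul]
    rfl
  have hint (m) : MeasureTheory.Integrable (fun k => q.coeff m k) μ :=
    (q.coeff m).continuous.integrable_of_hasCompactSupport (HasCompactSupport.of_compactSpace _)
  refine ⟨∑ m ∈ q.support, C (∫ k, q.coeff m k ∂μ) * monomial m 1, fun y x => ?_⟩
  simp only [hqe]
  refine ⟨MeasureTheory.integrable_finsetSum _ fun m _ => (hint m).mul_const _, ?_⟩
  rw [MeasureTheory.integral_finsetSum _ fun m _ => (hint m).mul_const _, map_sum]
  refine Finset.sum_congr rfl fun m _ => ?_
  rw [MeasureTheory.integral_mul_const, map_mul]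
  congr 1
  exact eval_C _

/-- The compact group `SU(3)`, as a subgroup of `SL(3, ℂ)`. -/
def unitarySubgroup : Subgroup (Matrix.SpecialLinearGroup (Fin 3) ℂ) where
  carrier := {g | (g : Matrix (Fin 3) (Fin 3) ℂ) ∈ unitaryGroup (Fin 3) ℂ}
  one_mem' := one_mem (unitaryGroup (Fin 3) ℂ)
  mul_mem' := fun {g h} hg hh => (unitaryGroup (Fin 3) ℂ).mul_mem hg hh
  inv_mem' := fun {g} hg => by
    have h1 : (g : Matrix (Fin 3) (Fin 3) ℂ) *
        ((g⁻¹ : Matrix.SpecialLinearGroup (Fin 3) ℂ) : Matrix (Fin 3) (Fin 3) ℂ) = 1 := by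
      rw [← Matrix.SpecialLinearGroup.coe_mul, mul_inv_cancel, Matrix.SpecialLinearGroup.coe_one]
    have h2 := left_inv_eq_right_inv (Unitary.star_mul_self_of_mem hg) h1
    rw [Set.mem_ofPred_eq, ← h2]
    exact Unitary.star_mem hg

theorem mem_unitarySubgroup {g : Matrix.SpecialLinearGroup (Fin 3) ℂ} :
    g ∈ unitarySubgroup ↔ (g : Matrix (Fin 3) (Fin 3) ℂ) ∈ unitaryGroup (Fin 3) ℂ :=
  Iff.rfl

theorem isCompact_unitaryGroup :
    IsCompact (unitaryGroup (Fin 3) ℂ : Set (Matrix (Fin 3) (Fin 3) ℂ)) := by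
  have h : IsCompact (X := Matrix (Fin 3) (Fin 3) ℂ) (Set.univ.pi fun _ : Fin 3 =>
      Set.univ.pi fun _ : Fin 3 => Metric.closedBall (0 : ℂ) 1) :=
    isCompact_univ_pi fun _ => isCompact_univ_pi fun _ => isCompact_closedBall 0 1
  refine h.of_isClosed_subset isClosed_unitary fun U hU i _ j _ => ?_
  simpa using entry_norm_bound_of_unitary hU i j

instance : CompactSpace unitarySubgroup := by
  have h : IsCompact (unitarySubgroup : Set (Matrix.SpecialLinearGroup (Fin 3) ℂ)) :=
    Matrix.SpecialLinearGroup.isClosedEmbedding_val.isCompact_preimage isCompact_unitaryGroup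
  exact isCompact_iff_compactSpace.1 h

/-- The **Reynolds operator**: averaging over `SU(3)`. -/
theorem exists_retraction (a b : ℕ) : ∃ E : Poly a b →ₗ[invariantRing a b] invariantRing a b,
    ∀ f : invariantRing a b, E f = f := by
  let _ : MeasurableSpace unitarySubgroup := borel _
  have : BorelSpace unitarySubgroup := ⟨rfl⟩
  let μ : MeasureTheory.Measure unitarySubgroup := MeasureTheory.Measure.haarMeasure ⊤
  have : MeasureTheory.IsProbabilityMeasure μ :=
    ⟨MeasureTheory.Measure.haarMeasure_self⟩
  choose E hE' using fun f : Poly a b => exists_evalAt_eq_integral μ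
    (F := fun k : unitarySubgroup => (k : Matrix.SpecialLinearGroup (Fin 3) ℂ)⁻¹)
    continuous_subtype_val.inv f
  have hE (f y x) := (hE' f y x).2
  have hmem (f : Poly a b) : E f ∈ invariantRing a b := by
    refine mem_of_forall_unitary fun g hg => evalAt_ext fun y x => ?_
    let g' : unitarySubgroup := ⟨g, mem_unitarySubgroup.2 hg⟩
    rw [evalAt_act, hE, hE]
    refine Eq.trans ?_ (MeasureTheory.integral_mul_left_eq_self _ g'⁻¹)
    refine MeasureTheory.integral_congr_ae (.of_forall fun k => ?_)
    have : ((g'⁻¹ * k : unitarySubgroup) : Matrix.SpecialLinearGroup (Fin 3) ℂ)⁻¹ =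
        (k : Matrix.SpecialLinearGroup (Fin 3) ℂ)⁻¹ * g := by
      simp [g', _root_.mul_inv_rev]
    simp only [this, act_mul]
    rw [evalAt_act g]
  refine ⟨⟨⟨fun f => ⟨E f, hmem f⟩, fun f h => Subtype.ext <| evalAt_ext fun y x => ?_⟩,
    fun f h => Subtype.ext <| evalAt_ext fun y x => ?_⟩,
    fun f => Subtype.ext <| evalAt_ext fun y x => ?_⟩
  · change evalAt y x (E (f + h)) = evalAt y x (E f + E h)
    simp only [map_add, hE]
    exact MeasureTheory.integral_add (hE' f y x).1 (hE' h y x).1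
  · change evalAt y x (E (f.1 * h)) = evalAt y x (f.1 * E h)
    simp only [map_mul, hE, mem_iff_act.1 f.2]
    exact MeasureTheory.integral_const_mul _ _
  · change evalAt y x (E f.1) = evalAt y x f.1
    simp [hE, mem_iff_act.1 f.2]

theorem act_isHomogeneous (g : Matrix.SpecialLinearGroup (Fin 3) ℂ) {f : Poly a b} {n : ℕ}
    (hf : f.IsHomogeneous n) : (act g f).IsHomogeneous n := by
  rw [← one_mul n]
  refine hf.aeval _ fun s => ?_
  rcases s with s | s
  · exact IsHomogeneous.sum _ _ _ fun k _ => (isHomogeneous_X _ _).mul (isHomogeneous_C _ _)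
  · refine IsHomogeneous.sum _ _ _ fun k _ => ?_
    simpa using (isHomogeneous_C _ _).mul (isHomogeneous_X ℂ (Sum.inr (k, s.2)))

theorem homogeneousComponent_act (g : Matrix.SpecialLinearGroup (Fin 3) ℂ) (f : Poly a b) (n : ℕ) :
    homogeneousComponent n (act g f) = act g (homogeneousComponent n f) := by
  conv_lhs => rw [← sum_homogeneousComponent f, map_sum, map_sum]
  have h (i : ℕ) : homogeneousComponent n (act g (homogeneousComponent i f)) =
      if n = i then act g (homogeneousComponent i f) else 0 :=
    homogeneousComponent_of_mem (act_isHomogeneous g (homogeneousComponent_isHomogeneous i f))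
  simp only [h, Finset.sum_ite_eq]
  split_ifs with hn
  · rfl
  · rw [homogeneousComponent_eq_zero, map_zero]
    rw [Finset.mem_range] at hn
    omega

theorem fg (a b : ℕ) : (invariantRing a b).FG := by
  obtain ⟨E, hE⟩ := exists_retraction a b
  refine Subalgebra.fg_of_retraction _ (fun f hf n => mem_iff_act.2 fun g => ?_) E hE
  rw [← homogeneousComponent_act, mem_iff_act.1 hf g]

end invariantRing

/-- The ring of invariants `R_{a,b}` is a finitely generated `ℂ`-algebra and a
unique factorization domain. -/
theorem invariantRing_fg_and_ufd (a b : ℕ) :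
    (invariantRing a b).FG ∧ UniqueFactorizationMonoid (invariantRing a b) :=
  ⟨invariantRing.fg a b, invariantRing.uniqueFactorizationMonoid⟩
end

section
/- First Fundamental Theorem of invariant theory for SL₃: the ring of invariants R_{a,b} is generated as a ℂ-algebra by the following multilinear polynomials: the dual Plücker coordinates P*_I, defined as the 3×3 minors of the generic a×3 matrix y on the row sets I (one for each 3-element subset I of Fin a); the Plücker coordinates P_J, defined as the 3×3 minors of the generic 3×b matrix x on the column sets J (one for each 3-element subset J of Fin b); and the pairings Q_{ij} = Σ_{l ∈ Fin 3} y_{il} x_{lj} (for i ∈ Fin a, j ∈ Fin b). That is, R_{a,b} equals the ℂ-subalgebra of P generated by all P*_I, all P_J, and all Q_{ij}. -/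
open Matrix MvPolynomial

/-- The generic `a × 3` matrix `y` of indeterminates. -/
noncomputable def genericY (a b : ℕ) :
    Matrix (Fin a) (Fin 3) (MvPolynomial ((Fin a × Fin 3) ⊕ (Fin 3 × Fin b)) ℂ) :=
  fun i l => MvPolynomial.X (Sum.inl (i, l))

/-- The generic `3 × b` matrix `x` of indeterminates. -/
noncomputable def genericX (a b : ℕ) :
    Matrix (Fin 3) (Fin b) (MvPolynomial ((Fin a × Fin 3) ⊕ (Fin 3 × Fin b)) ℂ) :=
  fun l j => MvPolynomial.X (Sum.inr (l, j))

/-- The Weyl generators: dual Plücker coordinates `P*_I` (3×3 minors of `y` on a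
3-element row set `I`), Plücker coordinates `P_J` (3×3 minors of `x` on a 3-element
column set `J`), and the pairings `Q_{ij} = Σ_l y_{il} x_{lj}`. -/
noncomputable def weylGenerators (a b : ℕ) :
    Set (MvPolynomial ((Fin a × Fin 3) ⊕ (Fin 3 × Fin b)) ℂ) :=
  {p | ∃ (I : Finset (Fin a)) (hI : I.card = 3),
      p = ((genericY a b).submatrix (I.orderEmbOfFin hI) id).det} ∪
  {p | ∃ (J : Finset (Fin b)) (hJ : J.card = 3),
      p = ((genericX a b).submatrix id (J.orderEmbOfFin hJ)).det} ∪
  {p | ∃ (i : Fin a) (j : Fin b), p = ∑ l : Fin 3, genericY a b i l * genericX a b l j}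

section VectorCalculus

variable {R : Type*} [CommRing R] [Algebra ℂ R]

/-- The gradient of `f` with respect to a triple of derivations. -/
def formalGradient (D : Fin 3 → Derivation ℂ R R) (f : R) : Fin 3 → R := fun k => D k f

/-- The curl of `v` with respect to a triple of derivations. -/
def formalCurl (D : Fin 3 → Derivation ℂ R R) (v : Fin 3 → R) : Fin 3 → R :=
  ![D 1 (v 2) - D 2 (v 1), D 2 (v 0) - D 0 (v 2), D 0 (v 1) - D 1 (v 0)]

/-- The divergence of `w` with respect to a triple of derivations. -/
def formalDivergence (D : Fin 3 → Derivation ℂ R R) (w : Fin 3 → R) : R :=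
  D 0 (w 0) + D 1 (w 1) + D 2 (w 2)

theorem formalGradient_add (D : Fin 3 → Derivation ℂ R R) (f g : R) :
    formalGradient D (f + g) = formalGradient D f + formalGradient D g := by
  ext k; simp [formalGradient]

theorem formalGradient_mul (D : Fin 3 → Derivation ℂ R R) (f g : R) :
    formalGradient D (f * g) = f • formalGradient D g + g • formalGradient D f := by
  ext k; simp [formalGradient]

theorem formalGradient_algebraMap (D : Fin 3 → Derivation ℂ R R) (r : ℂ) :
    formalGradient D (algebraMap ℂ R r) = 0 := by
  ext k; simp [formalGradient]

theorem formalCurl_zero (D : Fin 3 → Derivation ℂ R R) : formalCurl D 0 = 0 := by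
  ext k; fin_cases k <;> simp [formalCurl]

theorem formalCurl_add (D : Fin 3 → Derivation ℂ R R) (v w : Fin 3 → R) :
    formalCurl D (v + w) = formalCurl D v + formalCurl D w := by
  ext k; fin_cases k <;> simp [formalCurl] <;> ring

theorem formalCurl_smul (D : Fin 3 → Derivation ℂ R R) (f : R) (v : Fin 3 → R) :
    formalCurl D (f • v) = f • formalCurl D v + crossProduct (formalGradient D f) v := by
  ext k; fin_cases k <;> simp [formalCurl, formalGradient, cross_apply] <;> ring

theorem formalCurl_constSMul (D : Fin 3 → Derivation ℂ R R) (r : ℂ) (v : Fin 3 → R) :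
    formalCurl D (r • v) = r • formalCurl D v := by
  ext k; fin_cases k <;> simp [formalCurl, smul_sub]

theorem formalDivergence_constSMul (D : Fin 3 → Derivation ℂ R R) (r : ℂ) (v : Fin 3 → R) :
    formalDivergence D (r • v) = r • formalDivergence D v := by
  simp [formalDivergence, smul_add]

theorem formalDivergence_zero (D : Fin 3 → Derivation ℂ R R) : formalDivergence D 0 = 0 := by
  simp [formalDivergence]

theorem formalDivergence_add (D : Fin 3 → Derivation ℂ R R) (v w : Fin 3 → R) :
    formalDivergence D (v + w) = formalDivergence D v + formalDivergence D w := by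
  simp [formalDivergence]; ring

theorem formalDivergence_smul (D : Fin 3 → Derivation ℂ R R) (f : R) (v : Fin 3 → R) :
    formalDivergence D (f • v) = f * formalDivergence D v + formalGradient D f ⬝ᵥ v := by
  simp [formalDivergence, formalGradient, vec3_dotProduct]; ring

/-- `Dz = c • identity`: the derivations `D` act on the coordinates of `z` as the partial
derivatives with respect to `z`, scaled by `c`. -/
def ScalesCoordinates (D : Fin 3 → Derivation ℂ R R) (z : Fin 3 → R) (c : ℂ) : Prop :=
  ∀ k m, D k (z m) = if k = m then algebraMap ℂ R c else 0

theorem ScalesCoordinates.formalDivergence_eq {D : Fin 3 → Derivation ℂ R R}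
    {z : Fin 3 → R} {c : ℂ} (h : ScalesCoordinates D z c) :
    formalDivergence D z = algebraMap ℂ R (3 * c) := by
  simp [formalDivergence, h _ _, map_ofNat]; ring

theorem ScalesCoordinates.formalCurl_eq_zero {D : Fin 3 → Derivation ℂ R R}
    {z : Fin 3 → R} {c : ℂ} (h : ScalesCoordinates D z c) : formalCurl D z = 0 := by
  ext k; fin_cases k <;> simp [formalCurl, h _ _]

theorem ScalesCoordinates.formalGradient_dotProduct {D : Fin 3 → Derivation ℂ R R}
    {u v : Fin 3 → R} {c d : ℂ}
    (hu : ScalesCoordinates D u c) (hv : ScalesCoordinates D v d) :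
    formalGradient D (u ⬝ᵥ v) = c • v + d • u := by
  ext k; fin_cases k <;> simp [formalGradient, vec3_dotProduct, hu _ _, hv _ _, Algebra.smul_def] <;>
    ring

theorem ScalesCoordinates.formalCurl_cross {D : Fin 3 → Derivation ℂ R R}
    {u v : Fin 3 → R} {c d : ℂ}
    (hu : ScalesCoordinates D u c) (hv : ScalesCoordinates D v d) :
    formalCurl D (crossProduct u v) = (2 * d) • u - (2 * c) • v := by
  ext k; fin_cases k <;>
    simp [formalCurl, cross_apply, hu _ _, hv _ _, Algebra.smul_def, map_ofNat] <;> ring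

theorem ScalesCoordinates.formalDivergence_cross {D : Fin 3 → Derivation ℂ R R}
    {u v : Fin 3 → R} {c d : ℂ}
    (hu : ScalesCoordinates D u c) (hv : ScalesCoordinates D v d) :
    formalDivergence D (crossProduct u v) = 0 := by
  simp [formalDivergence, cross_apply, hu _ _, hv _ _]

theorem dotProduct_crossProduct {S : Type*} [CommRing S] (u v w : Fin 3 → S) :
    u ⬝ᵥ crossProduct v w = u 0 * (v 1 * w 2 - v 2 * w 1) + u 1 * (v 2 * w 0 - v 0 * w 2) +
      u 2 * (v 0 * w 1 - v 1 * w 0) := by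
  rw [vec3_dotProduct, cross_apply]
  rfl

theorem ScalesCoordinates.formalGradient_triple {D : Fin 3 → Derivation ℂ R R}
    {u v w : Fin 3 → R} {c d e : ℂ}
    (hu : ScalesCoordinates D u c) (hv : ScalesCoordinates D v d)
    (hw : ScalesCoordinates D w e) :
    formalGradient D (u ⬝ᵥ crossProduct v w) =
      c • crossProduct v w + d • crossProduct w u + e • crossProduct u v := by
  rw [dotProduct_crossProduct]
  ext k; fin_cases k <;>
    simp [formalGradient, cross_apply, hu _ _, hv _ _, hw _ _, Algebra.smul_def] <;>
    ring

/-- The Cayley omega operator `det (∂ₗₖ)` of a `3 × 3` array of derivations. -/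
def omega (D : Fin 3 → Fin 3 → Derivation ℂ R R) (f : R) : R :=
  formalDivergence (D 0) (formalCurl (D 1) (formalGradient (D 2) f))

end VectorCalculus

section Covariants

variable {R : Type*} [CommRing R] [Algebra ℂ R] {ι κ : Type*}

/-- The brackets and pairings of a family of covectors `z` and a family of vectors `x`. -/
def brackets (z : ι → Fin 3 → R) (x : κ → Fin 3 → R) : Set R :=
  {p | ∃ i j k, p = z i ⬝ᵥ crossProduct (z j) (z k)} ∪
  {p | ∃ i j k, p = x i ⬝ᵥ crossProduct (x j) (x k)} ∪
  {p | ∃ i j, p = z i ⬝ᵥ x j}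

/-- The basic vector-valued covariants of a family of covectors `z` and a family of
vectors `x`: the vectors themselves and the cross products of two covectors. -/
def basicCovariants (z : ι → Fin 3 → R) (x : κ → Fin 3 → R) : Set (Fin 3 → R) :=
  Set.range x ∪ {v | ∃ i j, v = crossProduct (z i) (z j)}

variable {z : ι → Fin 3 → R} {x : κ → Fin 3 → R} {A : Subalgebra ℂ R}

theorem cross_mem_span (hA : brackets z x ⊆ A) {v w : Fin 3 → R}
    (hv : v ∈ Submodule.span A (basicCovariants z x))
    (hw : w ∈ Submodule.span A (basicCovariants z x)) :
    crossProduct v w ∈ Submodule.span A (basicCovariants x z) := by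
  have key (p q : R) (u v : Fin 3 → R) (hp : p ∈ A) (hq : q ∈ A)
      (hu : u ∈ basicCovariants x z) (hv : v ∈ basicCovariants x z) :
      p • u - q • v ∈ Submodule.span A (basicCovariants x z) :=
    sub_mem (Submodule.smul_mem _ (⟨p, hp⟩ : A) (Submodule.subset_span hu))
      (Submodule.smul_mem _ (⟨q, hq⟩ : A) (Submodule.subset_span hv))
  have hz (i : ι) : z i ∈ basicCovariants x z := Or.inl ⟨i, rfl⟩
  have hzx (i : ι) (j : κ) : z i ⬝ᵥ x j ∈ A := hA (Or.inr ⟨i, j, rfl⟩)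
  have hzz (i j k : ι) : z i ⬝ᵥ crossProduct (z j) (z k) ∈ A := hA (Or.inl (Or.inl ⟨i, j, k, rfl⟩))
  induction hv, hw using Submodule.span_induction₂ with
  | mem_mem v w hv hw =>
    rcases hv with ⟨j, rfl⟩ | ⟨i, i', rfl⟩ <;> rcases hw with ⟨k, rfl⟩ | ⟨l, l', rfl⟩
    · exact Submodule.subset_span (Or.inr ⟨j, k, rfl⟩)
    · convert key _ _ _ _ (hzx l' j) (hzx l j) (hz l) (hz l') using 1
      ext k; fin_cases k <;> simp [cross_apply, vec3_dotProduct] <;> ring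
    · convert key _ _ _ _ (hzx i k) (hzx i' k) (hz i') (hz i) using 1
      ext k; fin_cases k <;> simp [cross_apply, vec3_dotProduct] <;> ring
    · convert key _ _ _ _ (hzz l' i i') (hzz l i i') (hz l) (hz l') using 1
      simp only [dotProduct_crossProduct]
      ext k; fin_cases k <;> simp [cross_apply] <;> ring
  | zero_left => simp
  | zero_right => simp
  | add_left _ _ _ _ _ _ h₁ h₂ => simpa using add_mem h₁ h₂
  | add_right _ _ _ _ _ _ h₁ h₂ => simpa using add_mem h₁ h₂
  | smul_left r v w _ _ h =>
    convert Submodule.smul_mem _ r h using 1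
    simp [Subalgebra.smul_def]
  | smul_right r v w _ _ h =>
    convert Submodule.smul_mem _ r h using 1
    simp [Subalgebra.smul_def]

theorem dotProduct_mem_of_mem_span (hA : brackets z x ⊆ A) {v w : Fin 3 → R}
    (hv : v ∈ Submodule.span A (basicCovariants z x))
    (hw : w ∈ Submodule.span A (basicCovariants x z)) : v ⬝ᵥ w ∈ A := by
  have hzx (i : ι) (j : κ) : z i ⬝ᵥ x j ∈ A := hA (Or.inr ⟨i, j, rfl⟩)
  induction hv, hw using Submodule.span_induction₂ with
  | mem_mem v w hv hw =>
    rcases hv with ⟨j, rfl⟩ | ⟨i, i', rfl⟩ <;> rcases hw with ⟨k, rfl⟩ | ⟨l, l', rfl⟩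
    · rw [dotProduct_comm]
      exact hzx k j
    · exact hA (Or.inl (Or.inr ⟨j, l, l', rfl⟩))
    · rw [dotProduct_comm]
      exact hA (Or.inl (Or.inl ⟨k, i, i', rfl⟩))
    · rw [cross_dot_cross]
      exact sub_mem (mul_mem (hzx _ _) (hzx _ _)) (mul_mem (hzx _ _) (hzx _ _))
  | zero_left => simp
  | zero_right => simp
  | add_left _ _ _ _ _ _ h₁ h₂ => simpa using add_mem h₁ h₂
  | add_right _ _ _ _ _ _ h₁ h₂ => simpa using add_mem h₁ h₂
  | smul_left r v w _ _ h =>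
    convert mul_mem r.2 h using 1
    simp [Subalgebra.smul_def]
  | smul_right r v w _ _ h =>
    convert mul_mem r.2 h using 1
    simp [Subalgebra.smul_def]

section Derivations

variable {D : Fin 3 → Derivation ℂ R R} {c : ι → ℂ}

theorem formalGradient_mem_span (hz : ∀ i, ScalesCoordinates D (z i) (c i))
    (hx : ∀ j, ScalesCoordinates D (x j) 0) {f : R} (hf : f ∈ Algebra.adjoin ℂ (brackets z x)) :
    formalGradient D f ∈
      Submodule.span (Algebra.adjoin ℂ (brackets z x)) (basicCovariants z x) := by
  set A := Algebra.adjoin ℂ (brackets z x)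
  set V := Submodule.span A (basicCovariants z x)
  have smul_mem (r : ℂ) (v : Fin 3 → R) (hv : v ∈ basicCovariants z x) : r • v ∈ V :=
    Submodule.smul_of_tower_mem _ r (Submodule.subset_span hv)
  induction hf using Algebra.adjoin_induction with
  | mem f hf =>
    rcases hf with (⟨i, j, k, rfl⟩ | ⟨i, j, k, rfl⟩) | ⟨i, j, rfl⟩
    · rw [(hz i).formalGradient_triple (hz j) (hz k)]
      exact add_mem (add_mem (smul_mem _ _ (Or.inr ⟨_, _, rfl⟩))
        (smul_mem _ _ (Or.inr ⟨_, _, rfl⟩))) (smul_mem _ _ (Or.inr ⟨_, _, rfl⟩))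
    · rw [(hx i).formalGradient_triple (hx j) (hx k)]
      simp
    · rw [(hz i).formalGradient_dotProduct (hx j), zero_smul, add_zero]
      exact smul_mem _ _ (Or.inl ⟨_, rfl⟩)
  | algebraMap r => simp [formalGradient_algebraMap]
  | add f g _ _ hf hg => simpa [formalGradient_add] using add_mem hf hg
  | mul f g hfA hgA hf hg =>
    rw [formalGradient_mul]
    exact add_mem (Submodule.smul_mem V (⟨f, hfA⟩ : A) hg) (Submodule.smul_mem V (⟨g, hgA⟩ : A) hf)

theorem formalCurl_mem_span (hz : ∀ i, ScalesCoordinates D (z i) (c i))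
    (hx : ∀ j, ScalesCoordinates D (x j) 0) {v : Fin 3 → R}
    (hv : v ∈ Submodule.span (Algebra.adjoin ℂ (brackets z x)) (basicCovariants z x)) :
    formalCurl D v ∈
      Submodule.span (Algebra.adjoin ℂ (brackets z x)) (basicCovariants x z) := by
  induction hv using Submodule.span_induction with
  | mem v hv =>
    rcases hv with ⟨j, rfl⟩ | ⟨i, j, rfl⟩
    · simp [(hx j).formalCurl_eq_zero]
    · rw [(hz i).formalCurl_cross (hz j)]
      exact sub_mem
        (Submodule.smul_of_tower_mem _ _ (Submodule.subset_span (Or.inl ⟨_, rfl⟩)))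
        (Submodule.smul_of_tower_mem _ _ (Submodule.subset_span (Or.inl ⟨_, rfl⟩)))
  | zero => simp [formalCurl_zero]
  | add v w _ _ hv hw => simpa [formalCurl_add] using add_mem hv hw
  | smul f v hvV hv =>
    rw [Subalgebra.smul_def, formalCurl_smul]
    exact add_mem (Submodule.smul_mem _ f hv)
      (cross_mem_span Algebra.subset_adjoin (formalGradient_mem_span hz hx f.2) hvV)

theorem formalDivergence_mem (hz : ∀ i, ScalesCoordinates D (z i) (c i))
    (hx : ∀ j, ScalesCoordinates D (x j) 0) {w : Fin 3 → R}
    (hw : w ∈ Submodule.span (Algebra.adjoin ℂ (brackets z x)) (basicCovariants x z)) :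
    formalDivergence D w ∈ Algebra.adjoin ℂ (brackets z x) := by
  induction hw using Submodule.span_induction with
  | mem v hv =>
    rcases hv with ⟨j, rfl⟩ | ⟨i, j, rfl⟩
    · rw [(hz j).formalDivergence_eq]
      exact Subalgebra.algebraMap_mem _ _
    · rw [(hx i).formalDivergence_cross (hx j)]
      exact zero_mem _
  | zero => simp [formalDivergence_zero]
  | add v w _ _ hv hw => simpa [formalDivergence_add] using add_mem hv hw
  | smul f v hvV hv =>
    rw [Subalgebra.smul_def, formalDivergence_smul]
    exact add_mem (mul_mem f.2 hv)
      (dotProduct_mem_of_mem_span Algebra.subset_adjoin (formalGradient_mem_span hz hx f.2) hvV)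

end Derivations

theorem omega_mem_adjoin_brackets {D : Fin 3 → Fin 3 → Derivation ℂ R R} {c : Fin 3 → ι → ℂ}
    (hz : ∀ l i, ScalesCoordinates (D l) (z i) (c l i))
    (hx : ∀ l j, ScalesCoordinates (D l) (x j) 0) {f : R}
    (hf : f ∈ Algebra.adjoin ℂ (brackets z x)) :
    omega D f ∈ Algebra.adjoin ℂ (brackets z x) :=
  formalDivergence_mem (hz 0) (hx 0)
    (formalCurl_mem_span (hz 1) (hx 1) (formalGradient_mem_span (hz 2) (hx 2) hf))

/-- Cayley's identity `Ω det ^ (s + 1) = (s + 1) (s + 2) (s + 3) det ^ s`. -/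
theorem omega_triple_pow_mul {D : Fin 3 → Fin 3 → Derivation ℂ R R} {g : Fin 3 → Fin 3 → R}
    (hg : ∀ l m, ScalesCoordinates (D l) (g m) (if l = m then 1 else 0)) {f : R}
    (hf : ∀ l k, D l k f = 0) (s : ℕ) :
    omega D ((g 0 ⬝ᵥ crossProduct (g 1) (g 2)) ^ (s + 1) * f) =
      ((s + 1) * (s + 2) * (s + 3) : ℂ) • ((g 0 ⬝ᵥ crossProduct (g 1) (g 2)) ^ s * f) := by
  have hgf (l : Fin 3) : formalGradient (D l) f = 0 := funext (hf l)
  set d := g 0 ⬝ᵥ crossProduct (g 1) (g 2) with hd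
  have hpow (l : Fin 3) (n : ℕ) :
      formalGradient (D l) (d ^ n * f) =
        (n : ℂ) • ((d ^ (n - 1) * f) • formalGradient (D l) d) := by
    rw [formalGradient_mul, hgf]
    ext k
    simp [formalGradient, Derivation.leibniz_pow, Algebra.smul_def]
    ring
  have h0 : formalGradient (D 0) d = crossProduct (g 1) (g 2) := by
    simp [hd, (hg 0 0).formalGradient_triple (hg 0 1) (hg 0 2)]
  have h1 : formalGradient (D 1) d = crossProduct (g 2) (g 0) := by
    simp [hd, (hg 1 0).formalGradient_triple (hg 1 1) (hg 1 2)]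
  have h2 : formalGradient (D 2) d = crossProduct (g 0) (g 1) := by
    simp [hd, (hg 2 0).formalGradient_triple (hg 2 1) (hg 2 2)]
  have hcross : crossProduct (crossProduct (g 2) (g 0)) (crossProduct (g 0) (g 1)) = d • g 0 := by
    rw [hd, dotProduct_crossProduct]
    ext k; fin_cases k <;> simp [cross_apply] <;> ring
  have hs : (s : ℂ) • (d ^ (s - 1) * f * d) = (s : ℂ) • (d ^ s * f) := by
    cases s with
    | zero => simp
    | succ s => rw [add_tsub_cancel_right, pow_succ, mul_right_comm]
  have hcurl : formalCurl (D 1) ((d ^ s * f) • crossProduct (g 0) (g 1)) =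
      (s + 2 : ℂ) • ((d ^ s * f) • g 0) := by
    rw [formalCurl_smul, (hg 1 0).formalCurl_cross (hg 1 1), hpow, h1,
      ← algebraMap_smul R (s : ℂ), map_smul, map_smul, LinearMap.smul_apply, LinearMap.smul_apply,
      hcross, smul_smul, smul_smul, mul_assoc, ← Algebra.smul_def, hs]
    simp
    module
  have hdiv : formalDivergence (D 0) ((d ^ s * f) • g 0) = (s + 3 : ℂ) • (d ^ s * f) := by
    rw [formalDivergence_smul, (hg 0 0).formalDivergence_eq, hpow, h0, smul_dotProduct,
      smul_dotProduct, dotProduct_comm, ← hd, smul_eq_mul, hs]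
    simp [Algebra.smul_def]
    ring
  rw [omega, hpow, h2, add_tsub_cancel_right, formalCurl_constSMul, hcurl,
    formalDivergence_constSMul, formalDivergence_constSMul, hdiv]
  push_cast
  module

end Covariants

section Homogeneity

variable {σ : Type*} (w : σ → ℕ)

theorem MvPolynomial.IsWeightedHomogeneous.eval_pow_mul {w : σ → ℕ} {n : ℕ}
    {f : MvPolynomial σ ℂ} (hf : f.IsWeightedHomogeneous w n) (t : ℂ) (p : σ → ℂ) :
    eval (fun i => t ^ w i * p i) f = t ^ n * eval p f := by
  induction hf using IsWeightedHomogeneous.induction_on with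
  | zero => simp
  | add f g _ _ hf hg => simp only [map_add, hf, hg, mul_add]
  | monomial d r hr =>
    simp only [eval_monomial, mul_pow, Finsupp.prod, Finset.prod_mul_distrib, ← pow_mul,
      Finset.prod_pow_eq_pow_sum]
    rw [← hr, Finsupp.weight_apply, Finsupp.sum]
    simp only [smul_eq_mul, mul_comm (w _)]
    ring

theorem coeff_aeval_C_mul_X_pow (f : MvPolynomial σ ℂ) (p : σ → ℂ) (n : ℕ) :
    (aeval (fun i => Polynomial.C (p i) * Polynomial.X ^ w i) f : Polynomial ℂ).coeff n =
      eval p (weightedHomogeneousComponent w n f) := by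
  induction f using MvPolynomial.induction_on' with
  | monomial d r =>
    rw [weightedHomogeneousComponent_of_mem (isWeightedHomogeneous_monomial w d r rfl)]
    have : (aeval (fun i => Polynomial.C (p i) * Polynomial.X ^ w i) (monomial d r) :
        Polynomial ℂ) = Polynomial.C (eval p (monomial d r)) *
          Polynomial.X ^ Finsupp.weight w d := by
      simp only [aeval_monomial, eval_monomial, mul_pow, Finsupp.prod, Finset.prod_mul_distrib,
        ← pow_mul, Finset.prod_pow_eq_pow_sum, Finsupp.weight_apply, Finsupp.sum, smul_eq_mul,
        mul_comm (w _), map_mul, map_prod, map_pow, mul_assoc]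
      rfl
    rw [this, Polynomial.coeff_C_mul_X_pow]
    split_ifs <;> simp
  | add f g hf hg => simp only [map_add, Polynomial.coeff_add, hf, hg]

theorem eval_weightedHomogeneousComponent_congr {f : MvPolynomial σ ℂ} {p q : σ → ℂ}
    (h : ∀ t : ℂ, eval (fun i => t ^ w i * p i) f = eval (fun i => t ^ w i * q i) f) (n : ℕ) :
    eval p (weightedHomogeneousComponent w n f) = eval q (weightedHomogeneousComponent w n f) := by
  rw [← coeff_aeval_C_mul_X_pow, ← coeff_aeval_C_mul_X_pow]
  congr 1
  refine Polynomial.funext fun t => ?_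
  have key (p : σ → ℂ) : Polynomial.eval t
      (aeval (fun i => Polynomial.C (p i) * Polynomial.X ^ w i) f) =
        eval (fun i => t ^ w i * p i) f := by
    rw [← Polynomial.coe_aeval_eq_eval, comp_aeval_apply, ← coe_aeval_eq_eval,
      RingHom.coe_coe]
    refine congrArg (fun q : σ → ℂ => aeval q f) (funext fun i => ?_)
    rw [map_mul, map_pow, Polynomial.aeval_X, Polynomial.aeval_C, mul_comm]
    rfl
  rw [key, key, h]

end Homogeneity

section Minors

theorem det_submatrix_mem_of_orderEmbOfFin {R : Type*} [CommRing R] [Algebra ℂ R]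
    {A : Subalgebra ℂ R} {n : ℕ} (M : Matrix (Fin n) (Fin 3) R)
    (hM : ∀ (I : Finset (Fin n)) (hI : I.card = 3),
      (M.submatrix (I.orderEmbOfFin hI) id).det ∈ A) (r : Fin 3 → Fin n) :
    (M.submatrix r id).det ∈ A := by
  by_cases hr : Function.Injective r
  · have hI : (Finset.univ.image r).card = 3 := by
      rw [Finset.card_image_of_injective _ hr]; simp
    set e := (Finset.univ.image r).orderIsoOfFin hI
    have hmem (i : Fin 3) : r i ∈ Finset.univ.image r :=
      Finset.mem_image_of_mem _ (Finset.mem_univ i)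
    have hσ : Function.Injective fun i => e.symm ⟨r i, hmem i⟩ := fun i j hij =>
      hr (Subtype.ext_iff.mp (e.symm.injective hij))
    let σ : Equiv.Perm (Fin 3) := Equiv.ofBijective _ (Finite.injective_iff_bijective.mp hσ)
    have : M.submatrix r id =
        (M.submatrix ((Finset.univ.image r).orderEmbOfFin hI) id).submatrix σ id := by
      ext i l
      simp [σ, e, ← Finset.coe_orderIsoOfFin_apply]
    rw [this, det_permute]
    exact mul_mem (intCast_mem A _) (hM _ hI)
  · obtain ⟨i, j, hij, hne⟩ := Function.not_injective_iff.mp hr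
    rw [det_zero_of_row_eq hne (by ext l; simp [hij])]
    exact zero_mem A

end Minors

section Frame

variable (a b : ℕ)

/-- The generic covectors: the rows of the generic `a × 3` matrix, and the rows of a generic
`3 × 3` matrix. -/
noncomputable def covectors : Fin a ⊕ Fin 3 → Fin 3 →
    MvPolynomial ((Fin 3 × Fin 3) ⊕ ((Fin a × Fin 3) ⊕ (Fin 3 × Fin b))) ℂ :=
  Sum.elim (fun i l => X (Sum.inr (Sum.inl (i, l)))) (fun l k => X (Sum.inl (l, k)))

/-- The generic vectors: the columns of the generic `3 × b` matrix. -/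
noncomputable def vectors : Fin b → Fin 3 →
    MvPolynomial ((Fin 3 × Fin 3) ⊕ ((Fin a × Fin 3) ⊕ (Fin 3 × Fin b))) ℂ :=
  fun j l => X (Sum.inr (Sum.inr (l, j)))

/-- The partial derivatives with respect to the entries of the generic `3 × 3` matrix. -/
noncomputable def frameDerivation (l k : Fin 3) :
    Derivation ℂ (MvPolynomial ((Fin 3 × Fin 3) ⊕ ((Fin a × Fin 3) ⊕ (Fin 3 × Fin b))) ℂ)
      (MvPolynomial ((Fin 3 × Fin 3) ⊕ ((Fin a × Fin 3) ⊕ (Fin 3 × Fin b))) ℂ) :=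
  pderiv (Sum.inl (l, k))

/-- The substitution `(y, x) ↦ (y * adjugate g, g * x)` with `g` a generic `3 × 3` matrix. -/
noncomputable def adjugateAction :
    MvPolynomial ((Fin a × Fin 3) ⊕ (Fin 3 × Fin b)) ℂ →ₐ[ℂ]
      MvPolynomial ((Fin 3 × Fin 3) ⊕ ((Fin a × Fin 3) ⊕ (Fin 3 × Fin b))) ℂ :=
  aeval (Sum.elim
    (fun p => covectors a b (Sum.inl p.1) ⬝ᵥ
      crossProduct (covectors a b (Sum.inr (p.2 + 1))) (covectors a b (Sum.inr (p.2 + 2))))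
    (fun p => covectors a b (Sum.inr p.1) ⬝ᵥ vectors a b p.2))

/-- Specialization of the generic `3 × 3` matrix to zero. -/
noncomputable def specializeZero :
    MvPolynomial ((Fin 3 × Fin 3) ⊕ ((Fin a × Fin 3) ⊕ (Fin 3 × Fin b))) ℂ →ₐ[ℂ]
      MvPolynomial ((Fin a × Fin 3) ⊕ (Fin 3 × Fin b)) ℂ :=
  aeval (Sum.elim 0 X)

variable {a b}

theorem adjugateAction_mem (f : MvPolynomial ((Fin a × Fin 3) ⊕ (Fin 3 × Fin b)) ℂ) :
    adjugateAction a b f ∈ Algebra.adjoin ℂ (brackets (covectors a b) (vectors a b)) := by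
  induction f using MvPolynomial.induction_on with
  | C r =>
    rw [← algebraMap_eq, AlgHom.commutes]
    exact Subalgebra.algebraMap_mem _ r
  | add f g hf hg => simpa using add_mem hf hg
  | mul_X f i hf =>
    rw [map_mul]
    refine mul_mem hf (Algebra.subset_adjoin ?_)
    rw [adjugateAction, aeval_X]
    rcases i with ⟨i, l⟩ | ⟨l, j⟩
    · exact Or.inl (Or.inl ⟨_, _, _, rfl⟩)
    · exact Or.inr ⟨_, _, rfl⟩

theorem eval_adjugateAction (v : (Fin 3 × Fin 3) ⊕ ((Fin a × Fin 3) ⊕ (Fin 3 × Fin b)) → ℂ)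
    (f : MvPolynomial ((Fin a × Fin 3) ⊕ (Fin 3 × Fin b)) ℂ) :
    eval v (adjugateAction a b f) =
      evalAt (Matrix.of (fun i l => v (Sum.inr (Sum.inl (i, l)))) *
          (Matrix.of fun l k => v (Sum.inl (l, k))).adjugate)
        ((Matrix.of fun l k => v (Sum.inl (l, k))) *
          Matrix.of fun l j => v (Sum.inr (Sum.inr (l, j)))) f := by
  rw [adjugateAction, ← coe_aeval_eq_eval, RingHom.coe_coe, comp_aeval_apply, evalAt,
    ← coe_aeval_eq_eval, RingHom.coe_coe]
  congr 2
  ext (⟨i, l⟩ | ⟨l, j⟩)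
  · simp only [Sum.elim_inl, dotProduct_crossProduct, adjugate_fin_three, mul_apply,
      Fin.sum_univ_three]
    fin_cases l <;>
      simp [covectors, -mul_eq_mul_left_iff, -mul_eq_mul_right_iff, -add_left_inj, -add_right_inj] <;>
      ring
  · simp [covectors, vectors, mul_apply, dotProduct]

theorem specializeZero_mem
    {f : MvPolynomial ((Fin 3 × Fin 3) ⊕ ((Fin a × Fin 3) ⊕ (Fin 3 × Fin b))) ℂ}
    (hf : f ∈ Algebra.adjoin ℂ (brackets (covectors a b) (vectors a b))) :
    specializeZero a b f ∈ Algebra.adjoin ℂ (weylGenerators a b) := by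
  set A := Algebra.adjoin ℂ (weylGenerators a b)
  have hy (r : Fin 3 → Fin a) : ((genericY a b).submatrix r id).det ∈ A :=
    det_submatrix_mem_of_orderEmbOfFin _ (fun I hI => by
      exact Algebra.subset_adjoin (Or.inl (Or.inl ⟨I, hI, rfl⟩))) r
  have hx (r : Fin 3 → Fin b) : ((genericX a b)ᵀ.submatrix r id).det ∈ A :=
    det_submatrix_mem_of_orderEmbOfFin _ (fun J hJ => by
      rw [← transpose_submatrix, det_transpose]
      exact Algebra.subset_adjoin (Or.inl (Or.inr ⟨J, hJ, rfl⟩))) r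
  have key : Algebra.adjoin ℂ (brackets (covectors a b) (vectors a b)) ≤
      A.comap (specializeZero a b) := by
    refine Algebra.adjoin_le ?_
    rintro p ((⟨i, j, k, hp⟩ | ⟨i, j, k, hp⟩) | ⟨i, j, hp⟩) <;>
      rw [SetLike.mem_coe, Subalgebra.mem_comap, hp]
    · rcases i with i | i <;> rcases j with j | j <;> rcases k with k | k
      case inl.inl.inl =>
        convert hy ![i, j, k] using 1
        rw [dotProduct_crossProduct, det_fin_three]
        simp [specializeZero, covectors, genericY]
        ring
      all_goals
        convert zero_mem A using 1
        rw [dotProduct_crossProduct]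
        simp [specializeZero, covectors]
    · convert hx ![i, j, k] using 1
      rw [dotProduct_crossProduct, det_fin_three]
      simp [specializeZero, vectors, genericX]
      ring
    · rcases i with i | i
      · refine Algebra.subset_adjoin (Or.inr ⟨i, j, ?_⟩)
        simp [specializeZero, covectors, vectors, genericY, genericX, dotProduct]
      · convert zero_mem A using 1
        simp [specializeZero, covectors, dotProduct]
  exact key hf

theorem scalesCoordinates_covectors_inr (l m : Fin 3) :
    ScalesCoordinates (frameDerivation a b l) (covectors a b (Sum.inr m))
      (if l = m then 1 else 0) := by
  intro k n
  by_cases h : l = m <;> by_cases h' : k = n <;>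
    simp [frameDerivation, covectors, pderiv_X, h, h', eq_comm]

theorem scalesCoordinates_covectors_inl (l : Fin 3) (i : Fin a) :
    ScalesCoordinates (frameDerivation a b l) (covectors a b (Sum.inl i)) 0 := by
  intro k n
  simp [frameDerivation, covectors, pderiv_X]

theorem scalesCoordinates_vectors (l : Fin 3) (j : Fin b) :
    ScalesCoordinates (frameDerivation a b l) (vectors a b j) 0 := by
  intro k n
  simp [frameDerivation, vectors, pderiv_X]

end Frame

section Invariants

variable {a b : ℕ}

/-- The weights for which `(y, x) ↦ (t ^ 2 • y, t • x)` is the scaling by `t`. -/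
def adjugateWeight (a b : ℕ) : (Fin a × Fin 3) ⊕ (Fin 3 × Fin b) → ℕ :=
  Sum.elim (fun _ => 2) (fun _ => 1)

theorem evalAt_smul (f : MvPolynomial ((Fin a × Fin 3) ⊕ (Fin 3 × Fin b)) ℂ) (t : ℂ)
    (y : Matrix (Fin a) (Fin 3) ℂ) (x : Matrix (Fin 3) (Fin b) ℂ) :
    evalAt (t ^ 2 • y) (t • x) f =
      eval (fun i => t ^ adjugateWeight a b i *
        Sum.elim (fun p : Fin a × Fin 3 => y p.1 p.2) (fun p : Fin 3 × Fin b => x p.1 p.2) i) f := by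
  rw [evalAt]
  congr 2
  ext (i | i) <;> simp [adjugateWeight]

theorem weightedHomogeneousComponent_mem_invariantRing
    {f : MvPolynomial ((Fin a × Fin 3) ⊕ (Fin 3 × Fin b)) ℂ} (hf : f ∈ invariantRing a b)
    (n : ℕ) : weightedHomogeneousComponent (adjugateWeight a b) n f ∈ invariantRing a b := by
  intro g y x
  refine eval_weightedHomogeneousComponent_congr _ (fun t => ?_) n
  rw [← evalAt_smul, ← evalAt_smul, ← hf g (t ^ 2 • y) (t • x), Matrix.smul_mul, Matrix.mul_smul]

theorem evalAt_adjugate_of_pow_eq_det {f : MvPolynomial ((Fin a × Fin 3) ⊕ (Fin 3 × Fin b)) ℂ}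
    (hf : f ∈ invariantRing a b) {n : ℕ} (hn : f.IsWeightedHomogeneous (adjugateWeight a b) n)
    {g : Matrix (Fin 3) (Fin 3) ℂ} {t : ℂ} (ht : t ^ 3 = g.det) (hg : g.det ≠ 0)
    (y : Matrix (Fin a) (Fin 3) ℂ) (x : Matrix (Fin 3) (Fin b) ℂ) :
    evalAt (y * g.adjugate) (g * x) f = t ^ n * evalAt y x f := by
  have ht0 : t ≠ 0 := by
    rintro rfl
    exact hg (by rw [← ht]; simp)
  let h : SpecialLinearGroup (Fin 3) ℂ := ⟨t⁻¹ • g, by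
    rw [det_smul, ← ht]
    simp [ht0]⟩
  have hadj : g.adjugate = t ^ 2 • (h⁻¹ : SpecialLinearGroup (Fin 3) ℂ).1 := by
    rw [show (h⁻¹).1 = h.1.adjugate from rfl, adjugate_smul, smul_smul]
    simp [ht0]
  have hg' : g = t • h.1 := by simp [h, ht0]
  rw [hadj, hg', Matrix.mul_smul, Matrix.smul_mul, evalAt_smul, hn.eval_pow_mul]
  congr 1
  exact hf h y x

theorem eq_zero_of_not_three_dvd {f : MvPolynomial ((Fin a × Fin 3) ⊕ (Fin 3 × Fin b)) ℂ}
    (hf : f ∈ invariantRing a b) {n : ℕ} (hn : f.IsWeightedHomogeneous (adjugateWeight a b) n)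
    (h : ¬ 3 ∣ n) : f = 0 := by
  obtain ⟨ω, hω⟩ : ∃ ω : ℂ, IsPrimitiveRoot ω 3 := ⟨_, Complex.isPrimitiveRoot_exp 3 (by norm_num)⟩
  refine MvPolynomial.funext fun v => ?_
  have key := evalAt_adjugate_of_pow_eq_det hf hn (g := 1) (t := ω) (by simp [hω.pow_eq_one])
    (by simp) (Matrix.of fun i l => v (Sum.inl (i, l)))
    (Matrix.of fun l j => v (Sum.inr (l, j)))
  have hω' : ω ^ n ≠ 1 := fun h' => h ((hω.pow_eq_one_iff_dvd n).mp h')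
  have hv : evalAt (Matrix.of fun i l => v (Sum.inl (i, l)))
    (Matrix.of fun l j => v (Sum.inr (l, j))) f =
      eval v f := by
    rw [evalAt]
    congr 2
    ext (i | i) <;> rfl
  rw [adjugate_one, Matrix.mul_one, Matrix.one_mul, hv] at key
  rw [map_zero]
  by_contra h0
  exact hω' (mul_right_cancel₀ h0 (by rw [← key, one_mul]))

theorem adjugateAction_eq_triple_pow_mul
    {f : MvPolynomial ((Fin a × Fin 3) ⊕ (Fin 3 × Fin b)) ℂ} (hf : f ∈ invariantRing a b) {n : ℕ}
    (hn : f.IsWeightedHomogeneous (adjugateWeight a b) (3 * n)) :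
    adjugateAction a b f =
      (covectors a b (Sum.inr 0) ⬝ᵥ
        crossProduct (covectors a b (Sum.inr 1)) (covectors a b (Sum.inr 2))) ^ n *
        rename Sum.inr f := by
  set d := covectors a b (Sum.inr 0) ⬝ᵥ
    crossProduct (covectors a b (Sum.inr 1)) (covectors a b (Sum.inr 2)) with hd
  have hdet (v : (Fin 3 × Fin 3) ⊕ ((Fin a × Fin 3) ⊕ (Fin 3 × Fin b)) → ℂ) :
      eval v d = (Matrix.of fun l k => v (Sum.inl (l, k))).det := by
    rw [hd, dotProduct_crossProduct, det_fin_three]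
    simp [covectors]
    ring
  have hd0 : d ≠ 0 := by
    intro h
    have := hdet (Sum.elim (fun p => (1 : Matrix (Fin 3) (Fin 3) ℂ) p.1 p.2) 0)
    rw [h, map_zero] at this
    refine zero_ne_one (this.trans ?_)
    exact det_one
  refine mul_right_cancel₀ hd0 (MvPolynomial.funext fun v => ?_)
  rw [map_mul, map_mul]
  by_cases h0 : eval v d = 0
  · rw [h0, mul_zero, mul_zero]
  congr 1
  obtain ⟨t, ht⟩ := IsAlgClosed.exists_pow_nat_eq (eval v d) (n := 3) (by norm_num)
  rw [hdet] at h0 ht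
  rw [eval_adjugateAction, evalAt_adjugate_of_pow_eq_det hf hn ht h0, pow_mul, ht, map_mul, map_pow,
    hdet, eval_rename, evalAt]
  congr 3
  ext (i | i) <;> rfl

theorem iterate_omega_triple_pow_mul (f : MvPolynomial ((Fin a × Fin 3) ⊕ (Fin 3 × Fin b)) ℂ)
    (n : ℕ) : ∃ c : ℂ, c ≠ 0 ∧
      (omega (frameDerivation a b))^[n] ((covectors a b (Sum.inr 0) ⬝ᵥ
        crossProduct (covectors a b (Sum.inr 1)) (covectors a b (Sum.inr 2))) ^ n *
          rename Sum.inr f) = rename Sum.inr (c • f) := by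
  induction n generalizing f with
  | zero => exact ⟨1, one_ne_zero, by simp⟩
  | succ n ih =>
    have hD (l k : Fin 3) (f : MvPolynomial ((Fin a × Fin 3) ⊕ (Fin 3 × Fin b)) ℂ) :
        frameDerivation a b l k (rename Sum.inr f) = 0 := by
      induction f using MvPolynomial.induction_on with
      | C r => simp [frameDerivation]
      | add f g hf hg => simp [hf, hg]
      | mul_X f i hf =>
        rw [map_mul, Derivation.leibniz, hf, rename_X]
        simp [frameDerivation, pderiv_X]
    set r : ℂ := (n + 1) * (n + 2) * (n + 3)
    obtain ⟨c, hc, h⟩ := ih (r • f)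
    have hr : r ≠ 0 := by
      simp only [r]
      norm_cast
    refine ⟨c * r, mul_ne_zero hc hr, ?_⟩
    rw [Function.iterate_succ_apply, omega_triple_pow_mul (g := fun l => covectors a b (Sum.inr l))
      scalesCoordinates_covectors_inr (fun l k => hD l k f), ← mul_smul_comm, ← map_smul, h,
      smul_smul]

theorem specializeZero_rename (f : MvPolynomial ((Fin a × Fin 3) ⊕ (Fin 3 × Fin b)) ℂ) :
    specializeZero a b (rename Sum.inr f) = f := by
  rw [specializeZero, aeval_rename, Sum.elim_comp_inr, aeval_X_left_apply]

theorem mem_adjoin_weylGenerators_of_isWeightedHomogeneous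
    {f : MvPolynomial ((Fin a × Fin 3) ⊕ (Fin 3 × Fin b)) ℂ} (hf : f ∈ invariantRing a b) {n : ℕ}
    (hn : f.IsWeightedHomogeneous (adjugateWeight a b) n) :
    f ∈ Algebra.adjoin ℂ (weylGenerators a b) := by
  by_cases h3 : 3 ∣ n
  · obtain ⟨m, rfl⟩ := h3
    obtain ⟨c, hc, h⟩ := iterate_omega_triple_pow_mul f m
    rw [← adjugateAction_eq_triple_pow_mul hf hn] at h
    have hmem : (omega (frameDerivation a b))^[m] (adjugateAction a b f) ∈
        Algebra.adjoin ℂ (brackets (covectors a b) (vectors a b)) := by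
      refine Set.MapsTo.iterate (f := omega (frameDerivation a b)) (fun p hp => ?_) m
        (adjugateAction_mem f)
      refine omega_mem_adjoin_brackets
        (c := fun l => Sum.elim (fun _ => 0) (fun m => if l = m then 1 else 0)) (fun l i => ?_)
        scalesCoordinates_vectors hp
      rcases i with i | m
      · exact scalesCoordinates_covectors_inl l i
      · exact scalesCoordinates_covectors_inr l m
    have := specializeZero_mem hmem
    rw [h, specializeZero_rename] at this
    simpa [smul_smul, hc] using Subalgebra.smul_mem _ this c⁻¹
  · rw [eq_zero_of_not_three_dvd hf hn h3]
    exact zero_mem _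

theorem evalAt_genericY (y : Matrix (Fin a) (Fin 3) ℂ) (x : Matrix (Fin 3) (Fin b) ℂ) :
    (genericY a b).map (evalAt y x) = y := by
  ext i l
  simp [genericY, evalAt]

theorem evalAt_genericX (y : Matrix (Fin a) (Fin 3) ℂ) (x : Matrix (Fin 3) (Fin b) ℂ) :
    (genericX a b).map (evalAt y x) = x := by
  ext l j
  simp [genericX, evalAt]

theorem weylGenerators_subset_invariantRing :
    weylGenerators a b ⊆ (invariantRing a b : Set _) := by
  rintro p ((⟨I, hI, hp⟩ | ⟨J, hJ, hp⟩) | ⟨i, j, hp⟩) g y x <;> rw [hp]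
  · rw [RingHom.map_det, RingHom.map_det, RingHom.mapMatrix_apply, RingHom.mapMatrix_apply,
      ← submatrix_map, ← submatrix_map, evalAt_genericY, evalAt_genericY,
      submatrix_mul _ _ _ id _ Function.bijective_id, det_mul, submatrix_id_id,
      show (g⁻¹).1.det = 1 from (g⁻¹).2, mul_one]
  · rw [RingHom.map_det, RingHom.map_det, RingHom.mapMatrix_apply, RingHom.mapMatrix_apply,
      ← submatrix_map, ← submatrix_map, evalAt_genericX, evalAt_genericX,
      submatrix_mul _ _ _ id _ Function.bijective_id, det_mul, submatrix_id_id,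
      show g.1.det = 1 from g.2, one_mul]
  · have key (y : Matrix (Fin a) (Fin 3) ℂ) (x : Matrix (Fin 3) (Fin b) ℂ) :
        evalAt y x (∑ l, genericY a b i l * genericX a b l j) = (y * x) i j := by
      simp [evalAt, genericY, genericX, mul_apply]
    rw [key, key, Matrix.mul_assoc, ← Matrix.mul_assoc _ g.1,
      show (g⁻¹).1 * g.1 = 1 from congrArg Subtype.val (inv_mul_cancel g), Matrix.one_mul]

end Invariants

/-- First Fundamental Theorem of invariant theory for `SL₃`: the ring of invariants
`R_{a,b}` is generated as a `ℂ`-algebra by the dual Plücker coordinates `P*_I`, the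
Plücker coordinates `P_J`, and the pairings `Q_{ij}`. -/
theorem first_fundamental_theorem (a b : ℕ) :
    invariantRing a b = Algebra.adjoin ℂ (weylGenerators a b) := by
  refine le_antisymm (fun f hf => ?_) (Algebra.adjoin_le weylGenerators_subset_invariantRing)
  rw [← sum_weightedHomogeneousComponent (adjugateWeight a b) f]
  exact finsum_induction (· ∈ Algebra.adjoin ℂ (weylGenerators a b)) (zero_mem _)
    (fun _ _ => add_mem) fun n => mem_adjoin_weylGenerators_of_isWeightedHomogeneous
      (weightedHomogeneousComponent_mem_invariantRing hf n)
      (weightedHomogeneousComponent_isWeightedHomogeneous n f)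
end

section
/- If a + b ≥ 5, then the Krull dimension of the ring of invariants R_{a,b} equals 3(a+b) − 8. -/
open Matrix MvPolynomial

/-- An integral extension does not raise the Krull dimension. -/
theorem ringKrullDim_le_of_isIntegral {A B : Type*} [CommRing A] [CommRing B] (f : A →+* B)
    (hf : f.IsIntegral) : ringKrullDim B ≤ ringKrullDim A := by
  algebraize [f]
  refine Order.krullDim_le_of_strictMono (PrimeSpectrum.comap f) fun p q hpq => ?_
  exact Ideal.IsIntegral.comap_lt_comap (R := A) (A := B) hpq

/-- The Krull dimension of a domain over a field is at most its transcendence degree. -/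
theorem ringKrullDim_le_of_trdeg_le {k A : Type*} [Field k] [CommRing A] [IsDomain A]
    [Algebra k A] {n : ℕ} (hn : Algebra.trdeg k A ≤ n) : ringKrullDim A ≤ n := by
  refine iSup_le fun l => ?_
  have hlt (i : Fin l.length) :
      ∃ x ∈ (l i.succ).asIdeal, x ∉ (l i.castSucc).asIdeal :=
    Set.exists_of_ssubset (l.strictMono i.castSucc_lt_succ)
  choose x hx hx' using hlt
  let B := Algebra.adjoin k (Set.range x)
  have hxB (i) : x i ∈ B := Algebra.subset_adjoin ⟨i, rfl⟩
  have : Algebra.FiniteType k B :=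
    (Subalgebra.fg_iff_finiteType _).1 (Subalgebra.fg_def.2 ⟨_, Set.finite_range x, rfl⟩)
  have hlen : (l.length : WithBot ℕ∞) ≤ ringKrullDim B := by
    let m : Fin (l.length + 1) → PrimeSpectrum B := fun i =>
      PrimeSpectrum.comap B.val.toRingHom (l i)
    have hm : StrictMono m := Fin.strictMono_iff_lt_succ.2 fun i => by
      refine lt_of_le_of_ne (Ideal.comap_mono (l.strictMono i.castSucc_lt_succ).le) fun h => ?_
      have hmem : (⟨x i, hxB i⟩ : B) ∈ (m i.succ).asIdeal := hx i
      rw [← h] at hmem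
      exact hx' i hmem
    exact Order.LTSeries.length_le_krullDim (LTSeries.mk l.length m hm)
  obtain ⟨s, g, hg, hint⟩ := exists_integral_inj_algHom_of_fg k B
  refine hlen.trans <| (ringKrullDim_le_of_isIntegral g.toRingHom hint).trans ?_
  have hs : s ≤ n := by
    have h1 := lift_trdeg_le_of_injective (B.val.comp g) (Subtype.val_injective.comp hg)
    have h2 := h1.trans (Cardinal.lift_le.2 hn)
    simpa using h2
  simpa using hs

/-- If `φ` maps `A` to a polynomial ring in `n` variables, the image becoming everything after
inverting an element `d` of it, then `A` has Krull dimension at least `n`. -/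
theorem natCast_le_ringKrullDim_of_mul_mem_range {k A : Type*} [Field k] [CommRing A] [Algebra k A]
    {n : ℕ} (φ : A →ₐ[k] MvPolynomial (Fin n) k) {d : MvPolynomial (Fin n) k} (p : Fin n → k)
    (hp : eval p d ≠ 0) (hd : d ∈ φ.range) (hX : ∀ i, d * X i ∈ φ.range) :
    n ≤ ringKrullDim A := by
  let ψ (j : ℕ) : MvPolynomial (Fin n) k →ₐ[k] MvPolynomial (Fin n) k :=
    aeval fun i => if i.val < j then C (p i) else X i
  have hψ (j) : ψ j d ≠ 0 := fun h => hp <| by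
    have : (aeval p).comp (ψ j) = aeval p := by
      ext i
      simp only [ψ, AlgHom.comp_apply, aeval_X]
      split_ifs <;> simp
    rw [← coe_aeval_eq_eval, RingHom.coe_coe, ← this, AlgHom.comp_apply, h, map_zero]
  let m : Fin (n + 1) → PrimeSpectrum A := fun i =>
    PrimeSpectrum.comap φ.toRingHom ⟨RingHom.ker (ψ i), RingHom.ker_isPrime _⟩
  have hm (i : Fin n) : m i.castSucc < m i.succ := by
    refine lt_of_le_of_ne (Ideal.comap_mono fun f hf => ?_) fun h => ?_
    · have : (aeval fun j => if j = i then C (p i) else X j).comp (ψ i.castSucc) = ψ i.succ := by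
        ext j : 1
        simp only [ψ, AlgHom.comp_apply, aeval_X, Fin.val_castSucc, Fin.val_succ]
        rcases lt_trichotomy j i with hj | rfl | hj
        · simp [hj, Nat.lt_succ_of_lt (Fin.lt_def.1 hj)]
        · simp
        · have := Fin.lt_def.1 hj
          simp [hj.ne', show ¬ j.val < i.val by omega, show ¬ j.val < i.val + 1 by omega]
      rw [RingHom.mem_ker] at hf ⊢
      rw [← this, AlgHom.comp_apply, hf, map_zero]
    · obtain ⟨u, hu⟩ : d * (X i - C (p i)) ∈ φ.range := by
        rw [mul_sub]
        exact sub_mem (hX i) (mul_mem hd (φ.range.algebraMap_mem (p i)))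
      change φ u = _ at hu
      have hmem : u ∈ (m i.succ).asIdeal := by
        change ψ i.succ (φ u) = 0
        simp [hu, ψ, MvPolynomial.algHom_C]
      rw [← h] at hmem
      have : ψ i.castSucc (φ u) = 0 := hmem
      rw [hu, map_mul, mul_eq_zero, or_iff_right (hψ _)] at this
      simp only [ψ, map_sub, aeval_X, algHom_C, Fin.val_castSucc, lt_irrefl, if_false,
        algebraMap_eq] at this
      simpa using congrArg (eval fun _ => p i + 1) this
  exact Order.LTSeries.length_le_krullDim (LTSeries.mk n m (Fin.strictMono_iff_lt_succ.2 hm))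

/-- A subalgebra of a polynomial ring that becomes everything after inverting one of its elements
has Krull dimension the number of variables. -/
theorem ringKrullDim_eq_card_of_mul_mem_range {k A σ : Type*} [Field k] [CommRing A] [Algebra k A]
    [Fintype σ] (φ : A →ₐ[k] MvPolynomial σ k) (hφ : Function.Injective φ) {d : MvPolynomial σ k}
    (p : σ → k) (hp : eval p d ≠ 0) (hd : d ∈ φ.range) (hX : ∀ i, d * X i ∈ φ.range) :
    ringKrullDim A = Fintype.card σ := by
  have : IsDomain A := hφ.isDomain φ.toRingHom
  refine le_antisymm (ringKrullDim_le_of_trdeg_le (k := k) ?_) ?_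
  · simpa using lift_trdeg_le_of_injective φ hφ
  · let e := renameEquiv k (Fintype.equivFin σ)
    have he {f} (hf : f ∈ φ.range) : e f ∈ (e.toAlgHom.comp φ).range := by
      obtain ⟨u, rfl⟩ := hf
      exact ⟨u, rfl⟩
    refine natCast_le_ringKrullDim_of_mul_mem_range (e.toAlgHom.comp φ) (d := e d)
      (p ∘ (Fintype.equivFin σ).symm) ?_ (he hd) fun i => ?_
    · simpa [e, eval_rename, Function.comp_assoc] using hp
    · simpa [e] using he (hX ((Fintype.equivFin σ).symm i))

section Invariants

variable {a b c : ℕ}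

theorem evalAt_X_inl (y : Matrix (Fin a) (Fin 3) ℂ) (x : Matrix (Fin 3) (Fin b) ℂ) (i l) :
    evalAt y x (X (Sum.inl (i, l))) = y i l := by
  simp [evalAt]

theorem evalAt_X_inr (y : Matrix (Fin a) (Fin 3) ℂ) (x : Matrix (Fin 3) (Fin b) ℂ) (l j) :
    evalAt y x (X (Sum.inr (l, j))) = x l j := by
  simp [evalAt]

/-- The `3 × 3` minor of `x` on the columns `j 0, j 1, j 2`. -/
noncomputable def minor (a : ℕ) (j : Fin 3 → Fin b) :
    MvPolynomial ((Fin a × Fin 3) ⊕ (Fin 3 × Fin b)) ℂ :=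
  det (of fun l k => X (Sum.inr (l, j k)))

/-- The `(i, j)` entry of the product `y * x`. -/
noncomputable def pairing (i : Fin a) (j : Fin b) :
    MvPolynomial ((Fin a × Fin 3) ⊕ (Fin 3 × Fin b)) ℂ :=
  ∑ l, X (Sum.inl (i, l)) * X (Sum.inr (l, j))

theorem evalAt_minor (y : Matrix (Fin a) (Fin 3) ℂ) (x : Matrix (Fin 3) (Fin b) ℂ)
    (j : Fin 3 → Fin b) : evalAt y x (minor a j) = (x.submatrix id j).det := by
  rw [minor, RingHom.map_det]
  congr 1
  ext l k
  simp [evalAt_X_inr]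

theorem evalAt_pairing (y : Matrix (Fin a) (Fin 3) ℂ) (x : Matrix (Fin 3) (Fin b) ℂ)
    (i : Fin a) (j : Fin b) : evalAt y x (pairing i j) = (y * x) i j := by
  simp [pairing, evalAt_X_inl, evalAt_X_inr, Matrix.mul_apply]

theorem minor_mem_invariantRing (j : Fin 3 → Fin b) : minor a j ∈ invariantRing a b := by
  intro g y x
  rw [evalAt_minor, evalAt_minor, ← Matrix.submatrix_mul_equiv _ _ id (Equiv.refl _) j, det_mul]
  simp

theorem pairing_mem_invariantRing (i : Fin a) (j : Fin b) :
    pairing i j ∈ invariantRing a b := by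
  intro g y x
  have hg : ((g⁻¹ : SpecialLinearGroup (Fin 3) ℂ) : Matrix (Fin 3) (Fin 3) ℂ) *
      (g : Matrix (Fin 3) (Fin 3) ℂ) = 1 :=
    congrArg Subtype.val (inv_mul_cancel g)
  rw [evalAt_pairing, evalAt_pairing, Matrix.mul_assoc, ← Matrix.mul_assoc _ _ x, hg,
    Matrix.one_mul]

/-- The matrix whose first three columns form `diag(d, 1, 1)` and whose other columns are
those of `z`. -/
def sliceMatrix {S : Type*} [CommRing S] (d : S) (z : Matrix (Fin 3) (Fin c) S) :
    Matrix (Fin 3) (Fin (3 + c)) S :=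
  of fun l => Fin.append (diagonal ![d, 1, 1] l) (z l)

/-- Restriction of polynomials to the slice of pairs `(y, sliceMatrix d z)`. -/
noncomputable def restrictSlice (a c : ℕ) :
    MvPolynomial ((Fin a × Fin 3) ⊕ (Fin 3 × Fin (3 + c))) ℂ →ₐ[ℂ]
      MvPolynomial (Unit ⊕ (Fin a × Fin 3) ⊕ (Fin 3 × Fin c)) ℂ :=
  aeval (Sum.elim (fun p => X (Sum.inr (Sum.inl p)))
    fun p => sliceMatrix (X (Sum.inl ())) (of fun l j => X (Sum.inr (Sum.inr (l, j)))) p.1 p.2)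

theorem eval_restrictSlice (d : ℂ) (y : Matrix (Fin a) (Fin 3) ℂ) (z : Matrix (Fin 3) (Fin c) ℂ)
    (f : MvPolynomial ((Fin a × Fin 3) ⊕ (Fin 3 × Fin (3 + c))) ℂ) :
    eval (Sum.elim (fun _ => d) (Sum.elim (fun p => y p.1 p.2) fun p => z p.1 p.2))
      (restrictSlice a c f) = evalAt y (sliceMatrix d z) f := by
  rw [evalAt, restrictSlice, ← coe_aeval_eq_eval, ← coe_aeval_eq_eval, RingHom.coe_coe,
    RingHom.coe_coe, ← AlgHom.comp_apply]
  congr 1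
  ext p
  rcases p with p | ⟨l, j⟩
  · simp
  · refine Fin.addCases (fun j => ?_) (fun j => ?_) j
    · fin_cases l <;> fin_cases j <;> simp [sliceMatrix]
    · simp [sliceMatrix]

theorem exists_mul_eq_sliceMatrix (x : Matrix (Fin 3) (Fin (3 + c)) ℂ)
    (hx : (x.submatrix id (Fin.castAdd c)).det ≠ 0) :
    ∃ (g : SpecialLinearGroup (Fin 3) ℂ) (d : ℂ) (z : Matrix (Fin 3) (Fin c) ℂ),
      (g : Matrix (Fin 3) (Fin 3) ℂ) * x = sliceMatrix d z := by
  set M := x.submatrix id (Fin.castAdd c) with hM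
  let N := diagonal ![M.det, 1, 1] * M⁻¹
  have hN : N.det = 1 := by
    simp [N, det_mul, det_nonsing_inv, Fin.prod_univ_three, hx]
  have hNM : N * M = diagonal ![M.det, 1, 1] := by
    rw [Matrix.mul_assoc, nonsing_inv_mul _ (isUnit_iff_ne_zero.2 hx), Matrix.mul_one]
  refine ⟨⟨N, hN⟩, M.det, (N * x).submatrix id (Fin.natAdd 3), ?_⟩
  ext l j
  refine Fin.addCases (fun j => ?_) (fun j => ?_) j
  · simp only [sliceMatrix, of_apply, Fin.append_left, ← hNM]
    rfl
  · simp [sliceMatrix]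

theorem restrictSlice_comp_val_injective :
    Function.Injective ((restrictSlice a c).comp (invariantRing a (3 + c)).val) := by
  refine (injective_iff_map_eq_zero _).2 fun ⟨f, hf⟩ hf0 => Subtype.ext ?_
  change restrictSlice a c f = 0 at hf0
  have hminor : minor a (Fin.castAdd c) ≠ 0 := fun h => by
    have := evalAt_minor (0 : Matrix (Fin a) (Fin 3) ℂ) (sliceMatrix 1 0) (Fin.castAdd c)
    rw [h, map_zero, det_fin_three] at this
    simp [sliceMatrix, diagonal] at this
  refine (mul_eq_zero.1 (MvPolynomial.funext fun v => ?_)).resolve_right hminor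
  let y : Matrix (Fin a) (Fin 3) ℂ := of fun i l => v (Sum.inl (i, l))
  let x : Matrix (Fin 3) (Fin (3 + c)) ℂ := of fun l j => v (Sum.inr (l, j))
  have hv : eval v = evalAt y x := by
    rw [evalAt]
    congr 1
    ext (_ | _) <;> rfl
  rw [hv, map_mul, map_zero, evalAt_minor]
  by_cases hx : (x.submatrix id (Fin.castAdd c)).det = 0
  · rw [hx, mul_zero]
  · obtain ⟨g, d, z, h⟩ := exists_mul_eq_sliceMatrix x hx
    rw [← hf g, h, ← eval_restrictSlice, hf0, map_zero, zero_mul]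

theorem restrictSlice_minor (j : Fin 3 → Fin (3 + c)) :
    restrictSlice a c (minor a j) = det (of fun l k =>
      sliceMatrix (X (Sum.inl ())) (of fun l j => X (Sum.inr (Sum.inr (l, j)))) l (j k)) := by
  rw [minor, AlgHom.map_det]
  congr 1
  ext l k : 1
  simp [restrictSlice]

theorem restrictSlice_pairing (i : Fin a) (j : Fin (3 + c)) :
    restrictSlice a c (pairing i j) = ∑ l, X (Sum.inr (Sum.inl (i, l))) *
      sliceMatrix (X (Sum.inl ())) (of fun l j => X (Sum.inr (Sum.inr (l, j)))) l j := by
  simp [pairing, restrictSlice]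

theorem ringKrullDim_invariantRing_add_three (a c : ℕ) :
    ringKrullDim (invariantRing a (3 + c)) = (3 * (a + c) + 1 : ℕ) := by
  let φ := (restrictSlice a c).comp (invariantRing a (3 + c)).val
  have hminor (j) : restrictSlice a c (minor a j) ∈ φ.range :=
    ⟨⟨_, minor_mem_invariantRing j⟩, rfl⟩
  have hpairing (i j) : restrictSlice a c (pairing i j) ∈ φ.range :=
    ⟨⟨_, pairing_mem_invariantRing i j⟩, rfl⟩
  simp only [restrictSlice_minor] at hminor
  simp only [restrictSlice_pairing, Fin.sum_univ_three] at hpairing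
  have hd : (X (Sum.inl ()) : MvPolynomial (Unit ⊕ (Fin a × Fin 3) ⊕ (Fin 3 × Fin c)) ℂ) ∈
      φ.range := by
    simpa [det_fin_three, sliceMatrix, diagonal] using hminor (Fin.castAdd c)
  rw [ringKrullDim_eq_card_of_mul_mem_range φ restrictSlice_comp_val_injective
    (d := X (Sum.inl ())) (fun _ => 1) (by simp) hd]
  · congr 1
    simp
    ring
  · rintro (_ | ⟨i, l⟩ | ⟨l, j⟩)
    · exact mul_mem hd hd
    · fin_cases l
      · simpa [sliceMatrix, diagonal, mul_comm] using hpairing i (Fin.castAdd c 0)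
      · simpa [sliceMatrix, diagonal] using mul_mem hd (hpairing i (Fin.castAdd c 1))
      · simpa [sliceMatrix, diagonal] using mul_mem hd (hpairing i (Fin.castAdd c 2))
    · fin_cases l
      · simpa [det_fin_three, sliceMatrix, diagonal] using
          mul_mem hd (hminor ![Fin.natAdd 3 j, Fin.castAdd c 1, Fin.castAdd c 2])
      · simpa [det_fin_three, sliceMatrix, diagonal] using
          hminor ![Fin.castAdd c 0, Fin.natAdd 3 j, Fin.castAdd c 2]
      · simpa [det_fin_three, sliceMatrix, diagonal] using
          hminor ![Fin.castAdd c 0, Fin.castAdd c 1, Fin.natAdd 3 j]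

/-- The relabelling of variables induced by `(y, x) ↦ (xᵀ, yᵀ)`. -/
def transposeVars (a b : ℕ) :
    (Fin a × Fin 3) ⊕ (Fin 3 × Fin b) ≃ (Fin b × Fin 3) ⊕ (Fin 3 × Fin a) :=
  (Equiv.sumComm _ _).trans ((Equiv.prodComm _ _).sumCongr (Equiv.prodComm _ _))

theorem evalAt_rename_transposeVars (y : Matrix (Fin b) (Fin 3) ℂ) (x : Matrix (Fin 3) (Fin a) ℂ)
    (f : MvPolynomial ((Fin a × Fin 3) ⊕ (Fin 3 × Fin b)) ℂ) :
    evalAt y x (rename (transposeVars a b) f) = evalAt xᵀ yᵀ f := by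
  rw [evalAt, evalAt, eval_rename]
  congr 2
  ext (_ | _) <;> rfl

theorem rename_transposeVars_mem {f : MvPolynomial ((Fin a × Fin 3) ⊕ (Fin 3 × Fin b)) ℂ}
    (hf : f ∈ invariantRing a b) : rename (transposeVars a b) f ∈ invariantRing b a := by
  intro g y x
  rw [evalAt_rename_transposeVars, evalAt_rename_transposeVars, ← hf g.transpose⁻¹ xᵀ yᵀ]
  simp [adjugate_transpose]

theorem map_transposeVars_invariantRing (a b : ℕ) :
    (invariantRing a b).map (renameEquiv ℂ (transposeVars a b) : _ →ₐ[ℂ] _) =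
      invariantRing b a := by
  refine le_antisymm ?_ fun f hf => ⟨_, rename_transposeVars_mem hf, ?_⟩
  · rintro _ ⟨f, hf, rfl⟩
    exact rename_transposeVars_mem hf
  · have : transposeVars a b ∘ transposeVars b a = id := by
      ext (_ | _) <;> rfl
    change rename _ (rename _ f) = f
    rw [rename_rename, this, rename_id_apply]

theorem ringKrullDim_invariantRing_comm (a b : ℕ) :
    ringKrullDim (invariantRing a b) = ringKrullDim (invariantRing b a) := by
  rw [← map_transposeVars_invariantRing a b]
  exact ringKrullDim_eq_of_ringEquiv
    ((renameEquiv ℂ (transposeVars a b)).subalgebraMap (invariantRing a b)).toRingEquiv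

end Invariants

/-- If `a + b ≥ 5`, the Krull dimension of the ring of invariants `R_{a,b}` is
`3(a+b) - 8`. -/
theorem krullDim_invariantRing (a b : ℕ) (h : 5 ≤ a + b) :
    ringKrullDim (invariantRing a b) = (3 * (a + b) - 8 : ℕ) := by
  wlog hb : 3 ≤ b generalizing a b
  · rw [ringKrullDim_invariantRing_comm, this b a (by omega) (by omega), add_comm b a]
  · obtain ⟨c, rfl⟩ := Nat.exists_eq_add_of_le hb
    rw [ringKrullDim_invariantRing_add_three]
    congr 1
    omega
end

section
/- Let b ∈ ℕ and consider the complex vector space of SL(3,ℂ)-invariant ℂ-multilinear maps M : (ℂ³)^b → ℂ. If 3 does not divide b, this space is zero. If b = 3n, then its dimension equals the number of standard Young tableaux of rectangular shape 3 × n, namely 2·(3n)! / (n! · (n+1)! · (n+2)!). -/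
open Matrix

/-- The space of `SL(3,ℂ)`-invariant `ℂ`-multilinear maps `(ℂ³)^b → ℂ`. -/
noncomputable def invariantMultilinear (b : ℕ) :
    Submodule ℂ (MultilinearMap ℂ (fun _ : Fin b => (Fin 3 → ℂ)) ℂ) where
  carrier := {M | ∀ (g : Matrix.SpecialLinearGroup (Fin 3) ℂ) (v : Fin b → Fin 3 → ℂ),
      M (fun i => (g : Matrix (Fin 3) (Fin 3) ℂ).mulVec (v i)) = M v}
  add_mem' := by
    intro M N hM hN g v
    simp only [MultilinearMap.add_apply, hM g v, hN g v]
  zero_mem' := by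
    intro g v
    simp
  smul_mem' := by
    intro c M hM g v
    simp only [MultilinearMap.smul_apply, hM g v]

attribute [local instance] LieRing.ofAssociativeRing

section HighestWeight

variable {X Y : Type*} [AddCommGroup X] [Module ℂ X] [AddCommGroup Y] [Module ℂ Y]

/-- The highest weight vectors of weight `μ` for an action of `3 × 3` matrices: the vectors killed
by the two simple raising operators on which the diagonal matrix units act through `μ`. -/
def highestWeight (ρ : Matrix (Fin 3) (Fin 3) ℂ → Module.End ℂ X) (μ : Fin 3 → ℤ) :
    Submodule ℂ X where
  carrier := {v | ρ (single 0 1 1) v = 0 ∧ ρ (single 1 2 1) v = 0 ∧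
    ∀ i, ρ (single i i 1) v = (μ i : ℂ) • v}
  add_mem' := by
    rintro v w ⟨h₁, h₂, h₃⟩ ⟨k₁, k₂, k₃⟩
    exact ⟨by simp [h₁, k₁], by simp [h₂, k₂], fun i => by simp [h₃, k₃]⟩
  zero_mem' := by simp
  smul_mem' := by
    rintro c v ⟨h₁, h₂, h₃⟩
    exact ⟨by simp [h₁], by simp [h₂], fun i => by simp [h₃, smul_comm c]⟩

theorem mem_highestWeight {ρ : Matrix (Fin 3) (Fin 3) ℂ → Module.End ℂ X} {μ : Fin 3 → ℤ} {v : X} :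
    v ∈ highestWeight ρ μ ↔ ρ (single 0 1 1) v = 0 ∧ ρ (single 1 2 1) v = 0 ∧
      ∀ i, ρ (single i i 1) v = (μ i : ℂ) • v :=
  Iff.rfl

theorem finrank_highestWeight_congr {ρ : Matrix (Fin 3) (Fin 3) ℂ → Module.End ℂ X}
    {σ : Matrix (Fin 3) (Fin 3) ℂ → Module.End ℂ Y} (Φ : X ≃ₗ[ℂ] Y)
    (h : ∀ A v, Φ (ρ A v) = σ A (Φ v)) (μ : Fin 3 → ℤ) :
    Module.finrank ℂ (highestWeight ρ μ) = Module.finrank ℂ (highestWeight σ μ) := by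
  have : highestWeight ρ μ = (highestWeight σ μ).comap Φ.toLinearMap := by
    ext v
    simp only [Submodule.mem_comap, mem_highestWeight, LinearEquiv.coe_coe, ← h, ← map_smul,
      EmbeddingLike.apply_eq_iff_eq, EmbeddingLike.map_eq_zero_iff]
  rw [this]
  exact (LinearEquiv.ofSubmodule' Φ _).finrank_eq

/-- The action of matrices on `X ⊗ ℂ³`, realised as `Fin 3 → X`. -/
def tensorStd (ρ : Matrix (Fin 3) (Fin 3) ℂ → Module.End ℂ X) (A : Matrix (Fin 3) (Fin 3) ℂ) :
    Module.End ℂ (Fin 3 → X) where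
  toFun T a := ρ A (T a) + ∑ i, A a i • T i
  map_add' T S := by
    ext a
    simp only [Pi.add_apply, map_add, smul_add, Finset.sum_add_distrib]
    abel
  map_smul' c T := by
    ext a
    simp only [Pi.smul_apply, map_smul, RingHom.id_apply, smul_add, Finset.smul_sum, smul_comm c]

theorem tensorStd_single (ρ : Matrix (Fin 3) (Fin 3) ℂ → Module.End ℂ X) (i j a : Fin 3)
    (T : Fin 3 → X) :
    tensorStd ρ (single i j 1) T a = ρ (single i j 1) (T a) + if a = i then T j else 0 := by
  simp only [tensorStd, LinearMap.coe_mk, AddHom.coe_mk, add_right_inj, single_apply]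
  split_ifs with h
  · simp [h]
  · simp [Ne.symm h]

theorem mem_highestWeight_tensorStd {ρ : Matrix (Fin 3) (Fin 3) ℂ → Module.End ℂ X}
    {μ : Fin 3 → ℤ} {T : Fin 3 → X} :
    T ∈ highestWeight (tensorStd ρ) μ ↔
      (ρ (single 0 1 1) (T 0) + T 1 = 0 ∧ ρ (single 0 1 1) (T 1) = 0 ∧
        ρ (single 0 1 1) (T 2) = 0) ∧
      (ρ (single 1 2 1) (T 0) = 0 ∧ ρ (single 1 2 1) (T 1) + T 2 = 0 ∧
        ρ (single 1 2 1) (T 2) = 0) ∧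
      ∀ i a, ρ (single i i 1) (T a) = ((μ - Pi.single a 1 : Fin 3 → ℤ) i : ℂ) • T a := by
  have hz : ∀ i a, (tensorStd ρ (single i i 1) T a = ((μ i : ℂ) • T) a ↔
      ρ (single i i 1) (T a) = ((μ - Pi.single a 1 : Fin 3 → ℤ) i : ℂ) • T a) := by
    intro i a
    rw [tensorStd_single, ← eq_sub_iff_add_eq]
    rcases eq_or_ne a i with rfl | h
    · simp [sub_smul]
    · simp [h, h.symm]
  simp only [mem_highestWeight, funext_iff, hz]
  simp [tensorStd_single, Fin.forall_fin_succ (n := 2), Fin.forall_fin_two]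

end HighestWeight

section Representation

variable {X : Type*} [AddCommGroup X] [Module ℂ X]
  (ρ : Matrix (Fin 3) (Fin 3) ℂ →ₗ⁅ℂ⁆ Module.End ℂ X)

theorem single_single_apply (i j k l : Fin 3) (v : X) :
    ρ (single i j 1) (ρ (single k l 1) v) = ρ (single k l 1) (ρ (single i j 1) v) +
      ((if j = k then ρ (single i l 1) v else 0) - if l = i then ρ (single k j 1) v else 0) := by
  have h := congrArg (fun f : Module.End ℂ X => f v) (ρ.map_lie (single i j 1) (single k l 1))
  simp only [Ring.lie_def, LinearMap.sub_apply, Module.End.mul_apply, map_sub] at h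
  rw [← sub_eq_iff_eq_add', ← h]
  congr 1
  · split_ifs with hjk
    · subst hjk; simp
    · simp [hjk]
  · split_ifs with hjk
    · subst hjk; simp
    · simp [hjk]

theorem diag_apply_single {μ : Fin 3 → ℂ} {v : X} (h : ∀ i, ρ (single i i 1) v = μ i • v)
    (j k i : Fin 3) :
    ρ (single i i 1) (ρ (single j k 1) v) =
      (μ i + ((if i = j then 1 else 0) - if i = k then 1 else 0)) • ρ (single j k 1) v := by
  rw [single_single_apply, h, map_smul, add_smul, sub_smul]
  congr 2
  · split_ifs with hij
    · subst hij; simp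
    · simp
  · by_cases hik : i = k
    · subst hik; simp
    · simp [hik, Ne.symm hik]

theorem isSl2Triple_single {i j : Fin 3} (hij : i ≠ j)
    (h0 : ρ (single i i 1) - ρ (single j j 1) ≠ 0) :
    IsSl2Triple (ρ (single i i 1) - ρ (single j j 1)) (ρ (single i j 1)) (ρ (single j i 1)) where
  h_ne_zero := h0
  lie_e_f := by
    rw [← ρ.map_lie, Ring.lie_def]; simp
  lie_h_e_nsmul := by
    rw [← map_sub, ← ρ.map_lie, Ring.lie_def, ← map_nsmul]
    congr 1
    simp [sub_mul, mul_sub, hij.symm, two_smul]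
  lie_h_f_nsmul := by
    rw [← map_sub, ← ρ.map_lie, Ring.lie_def, ← map_nsmul, ← map_neg]
    congr 1
    simp [sub_mul, mul_sub, hij, two_smul]
    abel

variable [FiniteDimensional ℂ X]

theorem le_of_raising_eq_zero {i j : Fin 3} (hij : i ≠ j) {v : X} (hv : v ≠ 0) {a b : ℤ}
    (he : ρ (single i j 1) v = 0) (hi : ρ (single i i 1) v = (a : ℂ) • v)
    (hj : ρ (single j j 1) v = (b : ℂ) • v) : b ≤ a := by
  by_contra! hlt
  have hh : (ρ (single i i 1) - ρ (single j j 1)) v = ((a : ℂ) - b) • v := by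
    rw [LinearMap.sub_apply, hi, hj, sub_smul]
  have h0 : ρ (single i i 1) - ρ (single j j 1) ≠ 0 := by
    intro h
    rw [h, LinearMap.zero_apply, eq_comm, smul_eq_zero_iff_left hv, sub_eq_zero] at hh
    exact hlt.ne (by exact_mod_cast hh)
  have P : (isSl2Triple_single ρ hij h0).HasPrimitiveVectorWith v ((a : ℂ) - b) :=
    ⟨hv, hh, he⟩
  obtain ⟨n, hn⟩ := P.exists_nat
  have : a - b = n := by exact_mod_cast hn
  omega

theorem lowering_eq_zero {i j : Fin 3} (hij : i ≠ j) {v : X} {a : ℂ}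
    (he : ρ (single i j 1) v = 0) (hi : ρ (single i i 1) v = a • v)
    (hj : ρ (single j j 1) v = a • v) : ρ (single j i 1) v = 0 := by
  by_cases hv : v = 0
  · simp [hv]
  have hh : (ρ (single i i 1) - ρ (single j j 1)) v = (0 : ℂ) • v := by
    rw [LinearMap.sub_apply, hi, hj, sub_self, zero_smul]
  by_cases h0 : ρ (single i i 1) - ρ (single j j 1) = 0
  · have h1 := single_single_apply ρ i i j i v
    have h2 := single_single_apply ρ j j j i v
    have h3 := congrArg (fun f : Module.End ℂ X => f (ρ (single j i 1) v)) h0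
    simp only [LinearMap.sub_apply, LinearMap.zero_apply, h1, h2, hi, hj, hij,
      if_true, if_false] at h3
    have h4 : (2 : ℂ) • ρ (single j i 1) v = 0 := by
      rw [← neg_eq_zero, ← h3, map_smul]; module
    simpa using h4
  · have P : (isSl2Triple_single ρ hij h0).HasPrimitiveVectorWith v (0 : ℂ) := ⟨hv, hh, he⟩
    simpa using P.pow_toEnd_f_eq_zero_of_eq_nat (n := 0) (by simp)

theorem highestWeight_eq_bot {μ : Fin 3 → ℤ} (h : μ 0 < μ 1 ∨ μ 1 < μ 2) :
    highestWeight ρ μ = ⊥ := by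
  rw [eq_bot_iff]
  rintro v ⟨h₁, h₂, h₃⟩
  by_contra hv
  have k₁ := le_of_raising_eq_zero ρ (by decide) hv h₁ (h₃ 0) (h₃ 1)
  have k₂ := le_of_raising_eq_zero ρ (by decide) hv h₂ (h₃ 1) (h₃ 2)
  omega

end Representation

section Branching

variable {X : Type*} [AddCommGroup X] [Module ℂ X]
  (ρ : Matrix (Fin 3) (Fin 3) ℂ →ₗ⁅ℂ⁆ Module.End ℂ X)

/-- The triangular map sending three vectors of `X` to an element of `X ⊗ ℂ³`. For `p`, `q` the
differences of consecutive entries of a dominant weight, it parametrises the highest weight vectors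
of that weight. -/
noncomputable def branchingMap (p q : ℂ) : X × X × X →ₗ[ℂ] (Fin 3 → X) where
  toFun S := ![S.1 - (p + 1)⁻¹ • ρ (single 1 0 1) S.2.1
      + ((q + 1)⁻¹ * (p + q + 2)⁻¹) • ((q + 2) • ρ (single 1 0 1) (ρ (single 2 1 1) S.2.2)
        - (q + 1) • ρ (single 2 1 1) (ρ (single 1 0 1) S.2.2)),
    S.2.1 - (q + 1)⁻¹ • ρ (single 2 1 1) S.2.2, S.2.2]
  map_add' S T := by
    ext i
    fin_cases i <;> simp <;> module
  map_smul' c S := by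
    ext i
    fin_cases i <;> simp <;> module

theorem branchingMap_injective (p q : ℂ) : Function.Injective (branchingMap ρ p q) := by
  rw [← LinearMap.ker_eq_bot, LinearMap.ker_eq_bot']
  rintro ⟨S₀, S₁, S₂⟩ h
  have h2 : S₂ = 0 := congrFun h 2
  have h1 := congrFun h 1
  have h0 := congrFun h 0
  subst h2
  simp only [branchingMap, LinearMap.coe_mk, AddHom.coe_mk, map_zero, smul_zero, sub_zero,
    cons_val_one, cons_val_zero, Pi.zero_apply] at h1
  subst h1
  simpa [branchingMap] using h0

variable {μ : Fin 3 → ℤ}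

theorem branchingMap_mem (h₀₁ : μ 1 ≤ μ 0) (h₁₂ : μ 2 ≤ μ 1) {S₀ S₁ S₂ : X}
    (h₀ : S₀ ∈ highestWeight ρ (μ - Pi.single 0 1)) (h₁ : S₁ ∈ highestWeight ρ (μ - Pi.single 1 1))
    (h₂ : S₂ ∈ highestWeight ρ (μ - Pi.single 2 1)) :
    branchingMap ρ (μ 0 - μ 1) (μ 1 - μ 2) (S₀, S₁, S₂) ∈ highestWeight (tensorStd ρ) μ := by
  obtain ⟨a₀, b₀, c₀⟩ := h₀
  obtain ⟨a₁, b₁, c₁⟩ := h₁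
  obtain ⟨a₂, b₂, c₂⟩ := h₂
  have hp : (μ 0 - μ 1 + 1 : ℂ) ≠ 0 := by
    have : (μ 0 - μ 1 + 1 : ℤ) ≠ 0 := by omega
    exact_mod_cast this
  have hq : (μ 1 - μ 2 + 1 : ℂ) ≠ 0 := by
    have : (μ 1 - μ 2 + 1 : ℤ) ≠ 0 := by omega
    exact_mod_cast this
  have hpq : (μ 0 - μ 2 + 2 : ℂ) ≠ 0 := by
    have : (μ 0 - μ 2 + 2 : ℤ) ≠ 0 := by omega
    exact_mod_cast this
  have d₁ := fun i j k => diag_apply_single ρ c₁ j k i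
  have d₂ := fun i j k => diag_apply_single ρ c₂ j k i
  have d₃ := fun i j k l m => diag_apply_single ρ (fun i => d₂ i j k) l m i
  rw [mem_highestWeight_tensorStd]
  refine ⟨⟨?_, ?_, ?_⟩, ⟨?_, ?_, ?_⟩, ?_⟩
  · simp [branchingMap, single_single_apply ρ 0 1, a₀, a₁, c₁, a₂, c₂, d₂]
    match_scalars <;> field_simp <;> ring
  · simp [branchingMap, single_single_apply ρ 0 1, a₁, a₂]
  · simp [branchingMap, a₂]
  · simp [branchingMap, single_single_apply ρ 1 2, b₀, b₁, b₂, c₂, d₂]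
    refine Or.inr ?_
    module
  · simp [branchingMap, single_single_apply ρ 1 2, b₁, b₂, c₂]
    match_scalars
    field_simp
    ring
  · simp [branchingMap, b₂]
  · intro i a
    fin_cases a <;> fin_cases i <;>
      simp [branchingMap, c₀, c₁, c₂, d₁, d₂, d₃] <;> module

theorem exists_branchingMap_eq (h₀₁ : μ 1 ≤ μ 0) (h₁₂ : μ 2 ≤ μ 1) {T : Fin 3 → X}
    (hT : T ∈ highestWeight (tensorStd ρ) μ) :
    ∃ S₀ ∈ highestWeight ρ (μ - Pi.single 0 1), ∃ S₁ ∈ highestWeight ρ (μ - Pi.single 1 1),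
      ∃ S₂ ∈ highestWeight ρ (μ - Pi.single 2 1),
        branchingMap ρ (μ 0 - μ 1) (μ 1 - μ 2) (S₀, S₁, S₂) = T := by
  have key := fun {S₀ S₁ S₂ : X} => branchingMap_mem ρ (S₀ := S₀) (S₁ := S₁) (S₂ := S₂) h₀₁ h₁₂
  set B := branchingMap ρ (μ 0 - μ 1) (μ 1 - μ 2) with hB
  have m₂ : T 2 ∈ highestWeight ρ (μ - Pi.single 2 1) := by
    obtain ⟨⟨-, -, h⟩, ⟨-, -, k⟩, l⟩ := mem_highestWeight_tensorStd.1 hT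
    exact ⟨h, k, fun i => l i 2⟩
  have hT' := Submodule.sub_mem _ hT (key (zero_mem _) (zero_mem _) m₂)
  set T' := T - B (0, 0, T 2) with hT'_def
  have e₂ : T' 2 = 0 := sub_self (T 2)
  have m₁ : T' 1 ∈ highestWeight ρ (μ - Pi.single 1 1) := by
    obtain ⟨⟨-, h, -⟩, ⟨-, k, -⟩, l⟩ := mem_highestWeight_tensorStd.1 hT'
    exact ⟨h, by simpa [e₂] using k, fun i => l i 1⟩
  have hT'' := Submodule.sub_mem _ hT' (key (zero_mem _) m₁ (zero_mem _))
  set T'' := T' - B (0, T' 1, 0) with hT''_def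
  have e₁ : T'' 1 = 0 := by
    rw [hT''_def, Pi.sub_apply, sub_eq_zero]
    simp only [hB, branchingMap, LinearMap.coe_mk, AddHom.coe_mk, map_zero, smul_zero, sub_zero,
      cons_val_one, cons_val_zero]
  have e₂' : T'' 2 = 0 := (sub_zero (T' 2)).trans e₂
  have m₀ : T'' 0 ∈ highestWeight ρ (μ - Pi.single 0 1) := by
    obtain ⟨⟨h, -, -⟩, ⟨k, -, -⟩, l⟩ := mem_highestWeight_tensorStd.1 hT''
    exact ⟨by simpa [e₁] using h, k, fun i => l i 0⟩
  refine ⟨_, m₀, _, m₁, _, m₂, ?_⟩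
  have e₀ : B (T'' 0, 0, 0) = T'' := by
    ext i
    fin_cases i <;> simp [hB, branchingMap, e₁, e₂']
  have hsplit : (T'' 0, T' 1, T 2) = (T'' 0, 0, 0) + (0, T' 1, 0) + ((0, 0, T 2) : X × X × X) := by
    simp
  rw [hsplit, map_add, map_add, e₀, hT''_def, sub_add_cancel, hT'_def, sub_add_cancel]

theorem finrank_highestWeight_tensorStd [FiniteDimensional ℂ X] (h₀₁ : μ 1 ≤ μ 0)
    (h₁₂ : μ 2 ≤ μ 1) :
    Module.finrank ℂ (highestWeight (tensorStd ρ) μ) =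
      ∑ i, Module.finrank ℂ (highestWeight ρ (μ - Pi.single i 1)) := by
  set H := fun i => highestWeight ρ (μ - Pi.single i 1) with hH
  have hinj : Function.Injective ((branchingMap ρ (μ 0 - μ 1) (μ 1 - μ 2)).comp
      ((H 0).subtype.prodMap ((H 1).subtype.prodMap (H 2).subtype))) := by
    rw [LinearMap.coe_comp]
    refine (branchingMap_injective ρ _ _).comp ?_
    exact (H 0).subtype_injective.prodMap ((H 1).subtype_injective.prodMap (H 2).subtype_injective)
  have hrange : highestWeight (tensorStd ρ) μ = LinearMap.range
      ((branchingMap ρ (μ 0 - μ 1) (μ 1 - μ 2)).comp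
        ((H 0).subtype.prodMap ((H 1).subtype.prodMap (H 2).subtype))) := by
    ext T
    constructor
    · intro hT
      obtain ⟨S₀, m₀, S₁, m₁, S₂, m₂, h⟩ := exists_branchingMap_eq ρ h₀₁ h₁₂ hT
      exact ⟨(⟨S₀, m₀⟩, ⟨S₁, m₁⟩, ⟨S₂, m₂⟩), h⟩
    · rintro ⟨⟨S₀, S₁, S₂⟩, rfl⟩
      exact branchingMap_mem ρ h₀₁ h₁₂ S₀.2 S₁.2 S₂.2
  rw [hrange, LinearMap.finrank_range_of_inj hinj, Module.finrank_prod, Module.finrank_prod,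
    Fin.sum_univ_three, add_assoc]

end Branching

section Counting

open Nat in
/-- The reciprocal of the factorial, extended by zero to negative integers. -/
def invFactorial (k : ℤ) : ℚ := if k < 0 then 0 else (k.toNat ! : ℚ)⁻¹

open Nat in
theorem invFactorial_natCast (n : ℕ) : invFactorial n = (n ! : ℚ)⁻¹ := by
  simp [invFactorial]

theorem invFactorial_of_neg {k : ℤ} (hk : k < 0) : invFactorial k = 0 := if_pos hk

theorem invFactorial_sub_one (k : ℤ) : invFactorial (k - 1) = k * invFactorial k := by
  rcases lt_trichotomy k 0 with hk | rfl | hk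
  · rw [invFactorial_of_neg hk, invFactorial_of_neg (by omega), mul_zero]
  · simp [invFactorial]
  · obtain ⟨n, rfl⟩ : ∃ n : ℕ, k = n + 1 := ⟨(k - 1).toNat, by omega⟩
    have h : ((n : ℤ) + 1) = ((n + 1 : ℕ) : ℤ) := by push_cast; rfl
    rw [add_sub_cancel_right, invFactorial_natCast, h, invFactorial_natCast, Nat.factorial_succ]
    push_cast
    have : (n : ℚ) + 1 ≠ 0 := by positivity
    rw [mul_inv, mul_inv_cancel_left₀ this]

open Nat in
/-- The determinantal expression for the number of standard Young tableaux with `b` boxes and rows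
of lengths `μ 0`, `μ 1` and `μ 2`. -/
def tableauCount (b : ℕ) (μ : Fin 3 → ℤ) : ℚ :=
  b ! * ((μ 0 - μ 1 + 1) * (μ 1 - μ 2 + 1) * (μ 0 - μ 2 + 2)) *
    (invFactorial (μ 0 + 2) * invFactorial (μ 1 + 1) * invFactorial (μ 2))

theorem tableauCount_succ {b : ℕ} {μ : Fin 3 → ℤ} (h : μ 0 + μ 1 + μ 2 = b + 1) :
    tableauCount (b + 1) μ = ∑ i, tableauCount b (μ - Pi.single i 1) := by
  have h' : (b : ℚ) + 1 = μ 0 + μ 1 + μ 2 := by exact_mod_cast h.symm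
  have e₀ : invFactorial (μ 0 - 1 + 2) = (μ 0 + 2) * invFactorial (μ 0 + 2) := by
    rw [show μ 0 - 1 + 2 = μ 0 + 2 - 1 by ring, invFactorial_sub_one]
    push_cast; rfl
  have e₁ : invFactorial (μ 1 - 1 + 1) = (μ 1 + 1) * invFactorial (μ 1 + 1) := by
    rw [show μ 1 - 1 + 1 = μ 1 + 1 - 1 by ring, invFactorial_sub_one]
    push_cast; rfl
  simp only [tableauCount, Fin.sum_univ_three, Pi.sub_apply, Pi.single_eq_same, ne_eq,
    Fin.reduceEq, not_false_eq_true, Pi.single_eq_of_ne, sub_zero, Int.cast_sub, Int.cast_one, e₀, e₁,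
    invFactorial_sub_one (μ 2), Nat.factorial_succ, Nat.cast_mul, Nat.cast_add, Nat.cast_one, h']
  ring

theorem tableauCount_zero {μ : Fin 3 → ℤ} (h : μ 0 + μ 1 + μ 2 = 0) (h₀₁ : μ 1 ≤ μ 0)
    (h₁₂ : μ 2 ≤ μ 1) : tableauCount 0 μ = if μ = 0 then 1 else 0 := by
  split_ifs with hμ
  · subst hμ
    simp [tableauCount, invFactorial]
  · have h2 : μ 2 < 0 := by
      by_contra! h2
      refine hμ (funext fun i => ?_)
      fin_cases i <;> simp <;> omega
    rw [tableauCount, invFactorial_of_neg h2, mul_zero, mul_zero]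

open Nat in
theorem tableauCount_rectangle (n : ℕ) :
    tableauCount (3 * n) (fun _ => (n : ℤ)) = 2 * (3 * n)! / (n ! * (n + 1)! * (n + 2)!) := by
  have h₁ : (n : ℤ) + 1 = (n + 1 : ℕ) := by push_cast; rfl
  have h₂ : (n : ℤ) + 2 = (n + 2 : ℕ) := by push_cast; rfl
  rw [tableauCount, h₁, h₂, invFactorial_natCast, invFactorial_natCast, invFactorial_natCast]
  simp only [Int.cast_natCast, sub_self, div_eq_mul_inv, mul_inv]
  ring

end Counting

section Polarization

open Function

/-- The derivation of multilinear forms that applies the transpose of `A` to one argument at a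
time. -/
noncomputable def polarize (b : ℕ) (A : Matrix (Fin 3) (Fin 3) ℂ) :
    Module.End ℂ (MultilinearMap ℂ (fun _ : Fin b => (Fin 3 → ℂ)) ℂ) where
  toFun M := ∑ k, M.compLinearMap (update (fun _ => LinearMap.id) k (toLin' Aᵀ))
  map_add' M N := by
    refine MultilinearMap.ext fun v => ?_
    simp [Finset.sum_add_distrib]
  map_smul' c M := by
    refine MultilinearMap.ext fun v => ?_
    simp [Finset.mul_sum]

theorem polarize_apply {b : ℕ} (A : Matrix (Fin 3) (Fin 3) ℂ)
    (M : MultilinearMap ℂ (fun _ : Fin b => (Fin 3 → ℂ)) ℂ) (v : Fin b → Fin 3 → ℂ) :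
    polarize b A M v = ∑ k, M (update v k (Aᵀ *ᵥ v k)) := by
  simp only [polarize, LinearMap.coe_mk, AddHom.coe_mk, _root_.sum_apply,
    MultilinearMap.compLinearMap_apply]
  refine Finset.sum_congr rfl fun k _ => congrArg M (funext fun j => ?_)
  rcases eq_or_ne j k with rfl | h
  · simp
  · simp [h]

theorem polarize_commutator {b : ℕ} (A B : Matrix (Fin 3) (Fin 3) ℂ)
    (M : MultilinearMap ℂ (fun _ : Fin b => (Fin 3 → ℂ)) ℂ) :
    polarize b (A * B - B * A) M = polarize b A (polarize b B M) - polarize b B (polarize b A M) := by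
  refine MultilinearMap.ext fun v => ?_
  rw [_root_.sub_apply]
  simp only [polarize_apply]
  rw [Finset.sum_comm (f := fun k l => M (update (update v k (Bᵀ *ᵥ v k)) l
    (Aᵀ *ᵥ update v k (Bᵀ *ᵥ v k) l))), ← Finset.sum_sub_distrib]
  refine Finset.sum_congr rfl fun k _ => ?_
  rw [← Finset.sum_sub_distrib, Finset.sum_eq_single k]
  · simp [sub_mulVec, mulVec_mulVec]
  · intro l _ hl
    rw [update_of_ne hl, update_of_ne hl.symm, update_comm hl, sub_self]
  · simp

/-- The representation of the Lie algebra of `3 × 3` matrices on multilinear forms. -/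
noncomputable def polarization (b : ℕ) : Matrix (Fin 3) (Fin 3) ℂ →ₗ⁅ℂ⁆
    Module.End ℂ (MultilinearMap ℂ (fun _ : Fin b => (Fin 3 → ℂ)) ℂ) where
  toFun := polarize b
  map_add' A B := by
    refine LinearMap.ext fun M => MultilinearMap.ext fun v => ?_
    simp [polarize_apply, add_mulVec, Finset.sum_add_distrib]
  map_smul' c A := by
    refine LinearMap.ext fun M => MultilinearMap.ext fun v => ?_
    simp [polarize_apply, smul_mulVec, Finset.mul_sum]
  map_lie' {A B} := by
    ext1 M
    exact polarize_commutator A B M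

theorem polarization_apply {b : ℕ} (A : Matrix (Fin 3) (Fin 3) ℂ)
    (M : MultilinearMap ℂ (fun _ : Fin b => (Fin 3 → ℂ)) ℂ) (v : Fin b → Fin 3 → ℂ) :
    polarization b A M v = ∑ k, M (update v k (Aᵀ *ᵥ v k)) :=
  polarize_apply A M v

/-- Splitting off the first argument of a multilinear form. -/
noncomputable def splitFirst (b : ℕ) :
    MultilinearMap ℂ (fun _ : Fin (b + 1) => (Fin 3 → ℂ)) ℂ ≃ₗ[ℂ]
      (Fin 3 → MultilinearMap ℂ (fun _ : Fin b => (Fin 3 → ℂ)) ℂ) :=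
  multilinearCurryLeftEquiv ℂ (fun _ : Fin (b + 1) => (Fin 3 → ℂ)) ℂ ≪≫ₗ
    ((Pi.basisFun ℂ (Fin 3)).constr ℂ).symm

theorem splitFirst_apply {b : ℕ} (M : MultilinearMap ℂ (fun _ : Fin (b + 1) => (Fin 3 → ℂ)) ℂ)
    (a : Fin 3) (v : Fin b → Fin 3 → ℂ) :
    splitFirst b M a v = M (Fin.cons (Pi.single a 1) v) := by
  simp [splitFirst, Module.Basis.constr]

theorem splitFirst_polarization {b : ℕ} (A : Matrix (Fin 3) (Fin 3) ℂ)
    (M : MultilinearMap ℂ (fun _ : Fin (b + 1) => (Fin 3 → ℂ)) ℂ) :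
    splitFirst b (polarization (b + 1) A M) = tensorStd (polarization b) A (splitFirst b M) := by
  refine funext fun a => MultilinearMap.ext fun v => ?_
  have hcol : Aᵀ *ᵥ Pi.single a 1 = ∑ i, A a i • (Pi.single i 1 : Fin 3 → ℂ) := by
    ext j
    simp [Finset.sum_apply, Pi.single_apply]
  have hfirst : M (Fin.cons (Aᵀ *ᵥ Pi.single a 1) v) =
      ∑ i, A a i * M (Fin.cons (Pi.single i 1) v) := by
    change M.curryLeft (Aᵀ *ᵥ Pi.single a 1) v = _
    simp [hcol]
  rw [splitFirst_apply, polarization_apply, Fin.sum_univ_succ]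
  simp only [Fin.cons_zero, Fin.cons_succ, Fin.update_cons_zero, ← Fin.cons_update, hfirst]
  simp [tensorStd, polarization_apply, splitFirst_apply, add_comm]

theorem finrank_highestWeight_polarization_of_not_dominant {b : ℕ} {μ : Fin 3 → ℤ}
    (h₀₁ : μ 1 ≤ μ 0 + 1) (h₁₂ : μ 2 ≤ μ 1 + 1) (h : μ 0 < μ 1 ∨ μ 1 < μ 2) :
    (Module.finrank ℂ (highestWeight (polarization b) μ) : ℚ) = tableauCount b μ := by
  rw [highestWeight_eq_bot _ h, finrank_bot, tableauCount]
  rcases h with hlt | hlt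
  · have : (μ 1 : ℚ) = μ 0 + 1 := by exact_mod_cast (by omega : μ 1 = μ 0 + 1)
    simp [this]
  · have : (μ 2 : ℚ) = μ 1 + 1 := by exact_mod_cast (by omega : μ 2 = μ 1 + 1)
    simp [this]

theorem finrank_highestWeight_polarization {b : ℕ} {μ : Fin 3 → ℤ} (h : μ 0 + μ 1 + μ 2 = b)
    (h₀₁ : μ 1 ≤ μ 0 + 1) (h₁₂ : μ 2 ≤ μ 1 + 1) :
    (Module.finrank ℂ (highestWeight (polarization b) μ) : ℚ) = tableauCount b μ := by
  induction b generalizing μ with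
  | zero =>
    by_cases hdom : μ 0 < μ 1 ∨ μ 1 < μ 2
    · exact finrank_highestWeight_polarization_of_not_dominant h₀₁ h₁₂ hdom
    push Not at hdom
    rw [tableauCount_zero (by simpa using h) hdom.1 hdom.2]
    have hpol : ∀ A M, polarization 0 A M = 0 := fun A M => by
      refine MultilinearMap.ext fun v => ?_
      simp [polarization_apply]
    split_ifs with hμ
    · have htop : highestWeight (polarization 0) μ = ⊤ := by
        rw [eq_top_iff]
        intro M _
        simp [mem_highestWeight, hpol, hμ]
      rw [htop, finrank_top, (MultilinearMap.constLinearEquivOfIsEmpty (R := ℂ) (S := ℂ)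
        (M₁ := fun _ : Fin 0 => (Fin 3 → ℂ)) (M₂ := ℂ)).symm.finrank_eq]
      simp
    · have hbot : highestWeight (polarization 0) μ = ⊥ := by
        rw [eq_bot_iff]
        rintro M ⟨-, -, hM⟩
        obtain ⟨i, hi⟩ := Function.ne_iff.1 hμ
        have := hM i
        rw [hpol, eq_comm, smul_eq_zero] at this
        exact this.resolve_left (by exact_mod_cast hi)
      rw [hbot, finrank_bot, Nat.cast_zero]
  | succ b ih =>
    by_cases hdom : μ 0 < μ 1 ∨ μ 1 < μ 2
    · exact finrank_highestWeight_polarization_of_not_dominant h₀₁ h₁₂ hdom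
    push Not at hdom
    rw [finrank_highestWeight_congr (splitFirst b) splitFirst_polarization,
      finrank_highestWeight_tensorStd _ hdom.1 hdom.2, tableauCount_succ (by exact_mod_cast h),
      Nat.cast_sum]
    push_cast at h
    refine Finset.sum_congr rfl fun i _ => ih ?_ ?_ ?_ <;>
      fin_cases i <;> simp <;> omega

end Polarization

section Invariance

open Function

variable {b : ℕ} (M : MultilinearMap ℂ (fun _ : Fin b => (Fin 3 → ℂ)) ℂ)

theorem MultilinearMap.apply_eq_sum_single (v : Fin b → Fin 3 → ℂ) :
    M v = ∑ r : Fin b → Fin 3, (∏ k, v k (r k)) * M fun k => Pi.single (r k) 1 := by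
  have hv : v = fun k => ∑ i, v k i • (Pi.single i 1 : Fin 3 → ℂ) :=
    funext fun k => pi_eq_sum_univ' (v k)
  conv_lhs => rw [hv]
  rw [M.map_sum]
  exact Finset.sum_congr rfl fun r _ => M.map_smul_univ _ _

theorem MultilinearMap.hasDerivAt_apply_line (u w : Fin b → Fin 3 → ℂ) (t : ℂ) :
    HasDerivAt (fun s : ℂ => M fun k => u k + s • w k)
      (∑ k, M (update (fun l => u l + t • w l) k (w k))) t := by
  have hcont : Continuous M := by
    rw [show ⇑M = _ from funext M.apply_eq_sum_single]
    fun_prop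
  let f : ContinuousMultilinearMap ℂ (fun _ : Fin b => (Fin 3 → ℂ)) ℂ := ⟨M, hcont⟩
  have hline : HasDerivAt (fun s : ℂ => u + s • w) w t := by
    simpa using ((hasDerivAt_id t).smul_const w).const_add u
  have h := (f.hasFDerivAt (u + t • w)).comp_hasDerivAt t hline
  rw [ContinuousMultilinearMap.linearDeriv_apply] at h
  exact h

/-- A multilinear form is killed by an elementary matrix exactly when it is invariant under the
transvections in the transposed direction. -/
theorem polarization_single_eq_zero_iff {i j : Fin 3} (hij : i ≠ j) :
    polarization b (single i j 1) M = 0 ↔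
      ∀ (t : ℂ) (v : Fin b → Fin 3 → ℂ), M (fun k => transvection j i t *ᵥ v k) = M v := by
  have htrans : ∀ (t : ℂ) (v : Fin b → Fin 3 → ℂ), (fun k => transvection j i t *ᵥ v k) =
      fun k => v k + t • ((single i j 1)ᵀ *ᵥ v k) := fun t v => funext fun k => by
    rw [transvection, add_mulVec, one_mulVec, ← smul_mulVec, transpose_single, smul_single,
      smul_eq_mul, mul_one]
  have hderiv : ∀ (t : ℂ) (v : Fin b → Fin 3 → ℂ),
      HasDerivAt (fun s : ℂ => M (fun k => transvection j i s *ᵥ v k))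
        (polarization b (single i j 1) M fun k => transvection j i t *ᵥ v k) t := fun t v => by
    have hsq : ∀ x : Fin 3 → ℂ, (single i j (1 : ℂ))ᵀ *ᵥ (x + t • ((single i j 1)ᵀ *ᵥ x)) =
        (single i j 1)ᵀ *ᵥ x := fun x => by
      rw [mulVec_add, mulVec_smul, mulVec_mulVec, transpose_single,
        single_mul_single_of_ne _ _ _ _ hij]
      simp
    simp only [htrans, polarization_apply, hsq]
    exact M.hasDerivAt_apply_line _ _ t
  refine ⟨fun h t v => ?_, fun h => MultilinearMap.ext fun v => ?_⟩
  · rw [h] at hderiv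
    have := is_const_of_deriv_eq_zero (fun s => (hderiv s v).differentiableAt)
      (fun s => (hderiv s v).deriv) t 0
    simpa using this
  · have hconst := hderiv 0 v
    simp only [h] at hconst
    simpa using hconst.unique (hasDerivAt_const _ _)

theorem polarization_one : polarization b 1 M = (b : ℂ) • M := by
  refine MultilinearMap.ext fun v => ?_
  simp [polarization_apply]

/-- Diagonal matrices act on multilinear forms of weight `(n, n, n)` by a power of the
determinant. -/
theorem apply_diagonal_mulVec {n : ℕ}
    (h : ∀ i, polarization b (single i i 1) M = (n : ℂ) • M) (d : Fin 3 → ℂ)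
    (v : Fin b → Fin 3 → ℂ) :
    M (fun k => diagonal d *ᵥ v k) = (diagonal d).det ^ n * M v := by
  have hword : ∀ r : Fin b → Fin 3, (∏ k, d (r k)) * (M fun k => Pi.single (r k) 1) =
      (diagonal d).det ^ n * M fun k => Pi.single (r k) 1 := fun r => by
    by_cases hr : (M fun k => Pi.single (r k) 1) = 0
    · simp [hr]
    have hcount : ∀ i, (Finset.univ.filter fun k => r k = i).card = n := fun i => by
      have hi := congrArg (fun N => N fun k => Pi.single (r k) 1) (h i)
      have hterm : ∀ k, M (update (fun k => Pi.single (r k) 1) k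
          ((single i i 1)ᵀ *ᵥ Pi.single (r k) 1)) =
          if r k = i then M fun k => Pi.single (r k) 1 else 0 := fun k => by
        split_ifs with hk
        · congr 1
          rw [update_eq_self_iff, hk]
          ext a
          simp [single_apply, Pi.single_apply, eq_comm]
        · refine M.map_coord_zero k ?_
          rw [update_self]
          ext a
          simp [Ne.symm hk]
      simp only [polarization_apply, hterm, _root_.smul_apply, smul_eq_mul] at hi
      rw [← Finset.sum_filter, Finset.sum_const, nsmul_eq_mul] at hi
      exact_mod_cast mul_right_cancel₀ hr hi
    rw [det_diagonal, ← Finset.prod_pow, ← Finset.prod_fiberwise' Finset.univ r d]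
    simp only [Finset.prod_const, hcount]
  rw [M.apply_eq_sum_single, M.apply_eq_sum_single v, Finset.mul_sum]
  refine Finset.sum_congr rfl fun r _ => ?_
  simp only [mulVec_diagonal, Finset.prod_mul_distrib]
  linear_combination (∏ k, v k (r k)) * hword r

theorem mem_invariantMultilinear_iff_mem_highestWeight {n : ℕ}
    {M : MultilinearMap ℂ (fun _ : Fin (3 * n) => (Fin 3 → ℂ)) ℂ} :
    M ∈ invariantMultilinear (3 * n) ↔ M ∈ highestWeight (polarization (3 * n)) fun _ => n := by
  constructor
  · intro hM
    have hoff : ∀ i j, i ≠ j → polarization (3 * n) (single i j 1) M = 0 := fun i j hij =>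
      (polarization_single_eq_zero_iff M hij).2 fun t v =>
        hM ⟨transvection j i t, det_transvection_of_ne _ _ hij.symm t⟩ v
    have hdiag : ∀ i j, polarization (3 * n) (single i i 1) M =
        polarization (3 * n) (single j j 1) M := fun i j => by
      rcases eq_or_ne i j with rfl | hij
      · rfl
      have := single_single_apply (polarization (3 * n)) i j j i M
      simp only [hoff _ _ hij, hoff _ _ hij.symm, map_zero, if_true, zero_add] at this
      exact sub_eq_zero.1 this.symm
    refine ⟨hoff _ _ (by decide), hoff _ _ (by decide), fun i => ?_⟩
    have hone : (1 : Matrix (Fin 3) (Fin 3) ℂ) = ∑ j, single j j 1 := by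
      ext a c
      fin_cases a <;> fin_cases c <;> simp [Fin.sum_univ_three]
    have hsum := polarization_one M
    rw [hone, map_sum, LinearMap.sum_apply, Finset.sum_congr rfl fun j _ => hdiag j i] at hsum
    simp only [Finset.sum_const, Finset.card_univ, Fintype.card_fin] at hsum
    have h3 : (3 : ℂ) • polarization (3 * n) (single i i 1) M = (3 : ℂ) • ((n : ℂ) • M) := by
      rw [smul_smul]
      exact_mod_cast hsum
    simpa using smul_right_injective _ (three_ne_zero (α := ℂ)) h3
  · rintro ⟨h01, h12, hdiag⟩
    simp only [Int.cast_natCast] at hdiag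
    have h10 := lowering_eq_zero _ (by decide) h01 (hdiag 0) (hdiag 1)
    have h21 := lowering_eq_zero _ (by decide) h12 (hdiag 1) (hdiag 2)
    have h02 : polarization (3 * n) (single 0 2 1) M = 0 := by
      simpa [h01, h12, eq_comm] using single_single_apply (polarization (3 * n)) 0 1 1 2 M
    have h20 : polarization (3 * n) (single 2 0 1) M = 0 := by
      simpa [h10, h21, eq_comm] using single_single_apply (polarization (3 * n)) 2 1 1 0 M
    have hoff : ∀ i j, i ≠ j → polarization (3 * n) (single i j 1) M = 0 := fun i j hij => by
      fin_cases i <;> fin_cases j <;> first | exact absurd rfl hij | assumption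
    have hdet : ∀ g : Matrix (Fin 3) (Fin 3) ℂ, g.det ≠ 0 →
        ∀ v, M (fun k => g *ᵥ v k) = g.det ^ n * M v := fun g hg => by
      refine diagonal_transvection_induction_of_det_ne_zero
        (fun g => ∀ v, M (fun k => g *ᵥ v k) = g.det ^ n * M v) g hg
        (fun d _ => apply_diagonal_mulVec M hdiag d) (fun t v => ?_) fun A B _ _ ihA ihB v => ?_
      · rw [TransvectionStruct.det, one_pow, one_mul]
        exact (polarization_single_eq_zero_iff M t.hij.symm).1 (hoff _ _ t.hij.symm) t.c v
      · simp only [← mulVec_mulVec]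
        rw [ihA, ihB, det_mul, mul_pow, mul_assoc]
    intro g v
    simpa using hdet g (by simp) v

theorem invariantMultilinear_eq_bot (h : ¬ 3 ∣ b) : invariantMultilinear b = ⊥ := by
  rw [eq_bot_iff]
  intro M hM
  obtain ⟨ω, hω⟩ : ∃ ω : ℂ, IsPrimitiveRoot ω 3 := ⟨_, Complex.isPrimitiveRoot_exp 3 (by norm_num)⟩
  have hdet : (ω • (1 : Matrix (Fin 3) (Fin 3) ℂ)).det = 1 := by simp [hω.pow_eq_one]
  refine (Submodule.mem_bot ℂ).2 (MultilinearMap.ext fun v => ?_)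
  have hv : M (fun k => ω • v k) = M v := by
    simpa [smul_mulVec] using hM ⟨_, hdet⟩ v
  rw [M.map_smul_univ (fun _ => ω) v] at hv
  have hne : ω ^ b ≠ 1 := fun h1 => h ((hω.pow_eq_one_iff_dvd b).1 h1)
  have : (ω ^ b - 1) * M v = 0 := by
    rw [sub_mul, one_mul, sub_eq_zero]
    simpa using hv
  simpa [sub_eq_zero, hne] using this

end Invariance

/-- The multilinear component of the ring of `SL₃` invariants of `b` vectors:
if `3 ∤ b` the space of invariant multilinear maps is zero, and if `b = 3n` its
dimension is the number of standard Young tableaux of shape `3 × n`, namely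
`2·(3n)! / (n!·(n+1)!·(n+2)!)` (hook length formula). -/
theorem dim_invariantMultilinear (b : ℕ) :
    (¬ (3 ∣ b) → invariantMultilinear b = ⊥) ∧
    (∀ n : ℕ, b = 3 * n →
      Module.finrank ℂ (invariantMultilinear b) =
        2 * Nat.factorial (3 * n) /
          (Nat.factorial n * Nat.factorial (n + 1) * Nat.factorial (n + 2))) := by
  refine ⟨invariantMultilinear_eq_bot, ?_⟩
  rintro n rfl
  have heq : invariantMultilinear (3 * n) = highestWeight (polarization (3 * n)) fun _ => n :=
    Submodule.ext fun M => mem_invariantMultilinear_iff_mem_highestWeight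
  have hrank := finrank_highestWeight_polarization (b := 3 * n) (μ := fun _ => n)
    (by push_cast; ring) (by simp) (by simp)
  rw [tableauCount_rectangle, ← heq, eq_div_iff (by positivity)] at hrank
  exact (Nat.div_eq_of_eq_mul_left (by positivity) (by exact_mod_cast hrank.symm)).symm
end
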